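/- arXiv:1202.6048 — 2 statements merged into one kernel-verified Lean document; each statement's English description precedes it below -/
import Mathlib

section
/- Let a, b be complex numbers. There exist a natural number N and a constant C > 0 such that for every natural number n > N the following holds: if μ ≠ ν are both periodic (when n is even) or both antiperiodic (when n is odd) eigenvalues for the potential a·exp(−2ix) + b·exp(2ix) with |μ − n²| ≤ 1 and |ν − n²| ≤ 1, then (μ − ν)² = 64·(ab)^n·16^{−n}·((n−1)!)^{−4}·(1 − ab/(2n³) + r_n) for some complex number r_n with |r_n| ≤ C·n^{−4}. -/
open Real Complex Set

/-- `λ` is an eigenvalue of the Mathieu operator `−y'' + (a e^{−2ix} + b e^{2ix}) y = λ y`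
on `[0,π]` with boundary conditions `y(π) = σ·y(0)`, `y'(π) = σ·y'(0)`;
`σ = 1` is the periodic and `σ = −1` the antiperiodic case. -/
def IsMathieuEig (a b : ℂ) (σ : ℂ) (lam : ℂ) : Prop :=
  ∃ y : ℝ → ℂ, ContDiff ℝ 2 y ∧
    (¬ ∀ x ∈ Set.Icc (0:ℝ) Real.pi, y x = 0) ∧
    (∀ x ∈ Set.Icc (0:ℝ) Real.pi,
      -(deriv (deriv y) x) +
        (a * Complex.exp (-(2 * Complex.I) * (x : ℂ)) +
          b * Complex.exp (2 * Complex.I * (x : ℂ))) * y x = lam * y x) ∧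
    y Real.pi = σ * y 0 ∧
    deriv y Real.pi = σ * deriv y 0

theorem eq_zero_of_integral_exp_mul_eq_zero {T : ℝ} (hT : 0 < T) {f : ℝ → ℂ}
    (hf : Continuous f) (hper : f 0 = f T)
    (h : ∀ j : ℤ, ∫ x in (0:ℝ)..T,
      Complex.exp (2 * Real.pi * Complex.I * (-j : ℤ) * x / T) * f x = 0) :
    ∀ x ∈ Set.Icc (0:ℝ) T, f x = 0 := by
  have : Fact (0 < T) := ⟨hT⟩
  let F : C(AddCircle T, ℂ) :=
    ⟨AddCircle.liftIco T 0 f, AddCircle.liftIco_zero_continuous hper hf.continuousOn⟩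
  have hcoef : ∀ j : ℤ, fourierCoeff F j = 0 := by
    intro j
    change fourierCoeff (AddCircle.liftIco T 0 f) j = 0
    rw [fourierCoeff_liftIco_eq, fourierCoeffOn_eq_integral]
    have key : ∫ x in (0:ℝ)..(0 + T), fourier (-j) (x : AddCircle (0 + T - 0)) • f x = 0 := by
      rw [← h j, zero_add]
      refine intervalIntegral.integral_congr fun x _ => ?_
      simp only [smul_eq_mul]
      rw [fourier_coe_apply, sub_zero]
    rw [key, smul_zero]
  have hF : ∀ x, F x = 0 := by
    intro x
    have hz : fourierCoeff F = 0 := funext hcoef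
    have hs : Summable (fourierCoeff F) := by rw [hz]; exact summable_zero
    have h1 := has_pointwise_sum_fourier_series_of_summable hs x
    simp only [hcoef, zero_smul] at h1
    exact h1.unique hasSum_zero
  have hIco : ∀ x ∈ Set.Ico (0:ℝ) T, f x = 0 := by
    intro x hx
    have h1 : AddCircle.liftIco T 0 f (x : AddCircle T) = 0 := hF x
    rwa [AddCircle.liftIco_zero_coe_apply hx] at h1
  intro x hx
  rcases hx.2.lt_or_eq with h1 | h1
  · exact hIco x ⟨hx.1, h1⟩
  · rw [h1, ← hper]
    exact hIco 0 ⟨le_rfl, hT⟩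

theorem exp_int_mul_I_pi_mul_sign (n : ℕ) (j : ℤ) :
    Complex.exp (-((2 * j - n : ℤ) : ℂ) * Complex.I * (Real.pi : ℝ)) *
      (if Even n then 1 else -1 : ℂ) = 1 := by
  have h1 : -((2 * j - n : ℤ) : ℂ) * Complex.I * (Real.pi : ℝ) =
      ((-j : ℤ) : ℂ) * (2 * Real.pi * Complex.I) + (n : ℂ) * (Real.pi * Complex.I) := by
    push_cast; ring
  rw [h1, Complex.exp_add, Complex.exp_int_mul_two_pi_mul_I, Complex.exp_nat_mul,
    Complex.exp_pi_mul_I, one_mul]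
  split_ifs with h
  · simp [h.neg_one_pow]
  · simp [(Nat.not_even_iff_odd.mp h).neg_one_pow]

/-- The Fourier coefficients of a (anti)periodic eigenfunction form a bounded nonzero solution of
a three-term recurrence. -/
theorem IsMathieuEig.exists_recurrence {a b lam : ℂ} {n : ℕ}
    (h : IsMathieuEig a b (if Even n then 1 else -1) lam) :
    ∃ u : ℤ → ℂ, (∃ M : ℝ, ∀ j, ‖u j‖ ≤ M) ∧ (∃ j, u j ≠ 0) ∧
      ∀ j : ℤ, (4 * j * (j - n) - (lam - (n : ℂ) ^ 2)) * u j + a * u (j + 1) + b * u (j - 1)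
        = 0 := by
  obtain ⟨y, hy, hne, hode, hb0, hb1⟩ := h
  set σ : ℂ := if Even n then 1 else -1 with hσ
  have hyd : Differentiable ℝ y := hy.differentiable (by norm_num)
  have hy1 : ContDiff ℝ 1 (deriv y) := ((contDiff_succ_iff_deriv (n := 1)).1 hy).2.2
  have hyd1 : Differentiable ℝ (deriv y) := hy1.differentiable (by norm_num)
  have hyc : Continuous y := hyd.continuous
  have hyc2 : Continuous (deriv (deriv y)) := hy1.continuous_deriv (by norm_num)
  let e : ℤ → ℝ → ℂ := fun j x => Complex.exp (-((2 * j - n : ℤ) : ℂ) * Complex.I * x)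
  have hec : ∀ j, Continuous (e j) := fun j => by fun_prop
  have hed : ∀ j x, HasDerivAt (e j) (-((2 * j - n : ℤ) : ℂ) * Complex.I * e j x) x := by
    intro j x
    have h1 : HasDerivAt (fun x : ℝ => -((2 * j - n : ℤ) : ℂ) * Complex.I * (x : ℂ))
        (-((2 * j - n : ℤ) : ℂ) * Complex.I * 1) x :=
      (Complex.ofRealCLM.hasDerivAt (x := x)).const_mul _
    have h2 := h1.cexp
    convert h2 using 1
    ring
  have heσ : ∀ j, e j Real.pi * σ = 1 := fun j => exp_int_mul_I_pi_mul_sign n j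
  have he0 : ∀ j, e j 0 = 1 := fun j => by simp [e]
  refine ⟨fun j => ∫ x in (0:ℝ)..Real.pi, e j x * y x, ?_, ?_, ?_⟩
  · refine ⟨∫ x in (0:ℝ)..Real.pi, ‖y x‖, fun j => ?_⟩
    refine (intervalIntegral.norm_integral_le_integral_norm Real.pi_pos.le).trans (le_of_eq ?_)
    refine intervalIntegral.integral_congr fun x _ => ?_
    have : ‖e j x‖ = 1 := by
      have h1 : -((2 * j - n : ℤ) : ℂ) * Complex.I * x
          = ((-((2 * j - n : ℤ) : ℝ) * x : ℝ) : ℂ) * Complex.I := by push_cast; ring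
      simp only [e]
      rw [h1, Complex.norm_exp_ofReal_mul_I]
    simp [this]
  · by_contra! hall
    apply hne
    have hz := eq_zero_of_integral_exp_mul_eq_zero (f := fun x => e 0 x * y x) Real.pi_pos
      ((hec 0).mul hyc) (by
        rw [hb0, ← mul_assoc, heσ, he0]) (by
        intro j
        rw [← hall j]
        refine intervalIntegral.integral_congr fun x _ => ?_
        simp only [e]
        rw [← mul_assoc, ← Complex.exp_add]
        congr 2
        have : (Real.pi : ℂ) ≠ 0 := by exact_mod_cast Real.pi_ne_zero
        field_simp
        push_cast
        ring)
    intro x hx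
    exact (mul_eq_zero.1 (hz x hx)).resolve_left (Complex.exp_ne_zero _)
  · intro j
    have hder : ∀ x ∈ Set.uIcc (0:ℝ) Real.pi, HasDerivAt
        (fun x => e j x * deriv y x + ((2 * j - n : ℤ) : ℂ) * Complex.I * (e j x * y x))
        (e j x * deriv (deriv y) x + ((2 * j - n : ℤ) : ℂ) ^ 2 * (e j x * y x)) x := by
      intro x _
      have h1 := ((hed j x).mul (hyd1 x).hasDerivAt).add
        (((hed j x).mul (hyd x).hasDerivAt).const_mul (((2 * j - n : ℤ) : ℂ) * Complex.I))
      refine h1.congr_deriv ?_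
      linear_combination (-(((2 * j - n : ℤ) : ℂ) ^ 2 * (e j x * y x))) * Complex.I_sq
    have hint := intervalIntegral.integral_eq_sub_of_hasDerivAt hder
      (Continuous.intervalIntegrable (by have := hec j; fun_prop) _ _)
    rw [hb0, hb1, he0] at hint
    have hbd : e j Real.pi * (σ * deriv y 0) +
        ((2 * j - n : ℤ) : ℂ) * Complex.I * (e j Real.pi * (σ * y 0)) -
        (1 * deriv y 0 + ((2 * j - n : ℤ) : ℂ) * Complex.I * (1 * y 0)) = 0 := by
      linear_combination (deriv y 0 + ((2 * j - n : ℤ) : ℂ) * Complex.I * y 0) * heσ j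
    rw [hbd] at hint
    have hii : ∀ k, IntervalIntegrable (fun x => e k x * y x) MeasureTheory.volume 0 Real.pi :=
      fun k => ((hec k).mul hyc).intervalIntegrable _ _
    rw [← hint, ← intervalIntegral.integral_const_mul, ← intervalIntegral.integral_const_mul,
      ← intervalIntegral.integral_const_mul, ← intervalIntegral.integral_add
        ((hii j).const_mul _) ((hii (j+1)).const_mul _), ← intervalIntegral.integral_add
        (((hii j).const_mul _).add ((hii (j+1)).const_mul _)) ((hii (j-1)).const_mul _)]
    refine intervalIntegral.integral_congr fun x hx => ?_
    rw [Set.uIcc_of_le Real.pi_pos.le] at hx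
    have h1 := hode x hx
    have hp : e (j + 1) x = e j x * Complex.exp (-(2 * Complex.I) * (x : ℂ)) := by
      simp only [e]
      rw [← Complex.exp_add]
      congr 1
      push_cast; ring
    have hm : e (j - 1) x = e j x * Complex.exp (2 * Complex.I * (x : ℂ)) := by
      simp only [e]
      rw [← Complex.exp_add]
      congr 1
      push_cast; ring
    simp only [hp, hm]
    push_cast
    linear_combination (e j x) * h1

/-! ### Continued fractions -/

theorem le_two_mul_of_le_add_half {x : ℕ → ℝ} {c M : ℝ} (hc : 0 ≤ c) (hM : ∀ k, x k ≤ M)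
    (h : ∀ k, x k ≤ c + x (k + 1) / 2) (k : ℕ) : x k ≤ 2 * c := by
  have h1 : ∀ m : ℕ, ∀ k, x k ≤ 2 * c + M * (1 / 2) ^ m := by
    intro m
    induction m with
    | zero => intro k; simpa using (hM k).trans (by linarith)
    | succ m ih =>
      intro k
      have h2 := h k
      have h3 := ih (k + 1)
      rw [pow_succ]
      linarith
  have h2 : Filter.Tendsto (fun m : ℕ => 2 * c + M * (1 / 2 : ℝ) ^ m) Filter.atTop
      (nhds (2 * c + M * 0)) :=
    ((tendsto_pow_atTop_nhds_zero_of_lt_one (by norm_num) (by norm_num)).const_mul M).const_add _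
  rw [mul_zero, add_zero] at h2
  exact ge_of_tendsto' h2 fun m => h1 m k

theorem norm_mul_le_half {w t : ℂ} {N : ℝ} (hN : 0 < N) (hw : 2 * ‖w‖ ≤ N) (ht : ‖t‖ ≤ 1 / N) :
    ‖w * t‖ ≤ 1 / 2 := by
  rw [norm_mul]
  calc ‖w‖ * ‖t‖ ≤ (N / 2) * (1 / N) := by gcongr; linarith
    _ = 1 / 2 := by field_simp

theorem continuedFraction_step {d w t : ℂ} {N : ℝ} (hN : 2 ≤ N) (hw : 2 * ‖w‖ ≤ N)
    (hd : 2 * N ≤ ‖d‖) (ht : ‖t‖ ≤ 1 / N) :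
    d - w * t ≠ 0 ∧ ‖(d - w * t)⁻¹‖ ≤ 1 / N := by
  have h1 := norm_mul_le_half (by linarith) hw ht
  have h2 : N ≤ ‖d - w * t‖ := by
    have := norm_sub_norm_le d (w * t)
    linarith
  refine ⟨norm_pos_iff.1 (by linarith), ?_⟩
  rw [norm_inv, one_div]
  exact inv_anti₀ (by linarith) h2

/-- If `s = 1 / (d₁ - w s')` and `t = 1 / (d₂ - w t')`, then `s - t` is controlled by `d₂ - d₁`
and `s' - t'`. -/
theorem sub_of_continuedFraction {w s s' t t' d₁ d₂ : ℂ} (hs : s * (d₁ - w * s') = 1)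
    (ht : t * (d₂ - w * t') = 1) :
    s - t = s * t * ((d₂ - d₁) + w * (s' - t')) := by
  linear_combination t * hs - s * ht

theorem norm_sub_le_of_continuedFraction {w s s' t t' d₁ d₂ : ℂ} {N : ℝ} (hN : 2 ≤ N)
    (hw : 2 * ‖w‖ ≤ N) (hs : s * (d₁ - w * s') = 1) (ht : t * (d₂ - w * t') = 1)
    (hs' : ‖s‖ ≤ 1 / N) (ht' : ‖t‖ ≤ 1 / N) :
    ‖s - t‖ ≤ ‖d₁ - d₂‖ / N ^ 2 + ‖s' - t'‖ / 2 / N := by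
  have hN0 : 0 < N := by linarith
  rw [sub_of_continuedFraction hs ht, norm_mul, norm_mul]
  have h1 : ‖(d₂ - d₁) + w * (s' - t')‖ ≤ ‖d₁ - d₂‖ + N / 2 * ‖s' - t'‖ := by
    refine (norm_add_le _ _).trans ?_
    rw [norm_sub_rev d₂, norm_mul]
    gcongr
    linarith
  calc ‖s‖ * ‖t‖ * ‖(d₂ - d₁) + w * (s' - t')‖
      ≤ (1 / N) * (1 / N) * (‖d₁ - d₂‖ + N / 2 * ‖s' - t'‖) := by gcongr
    _ = _ := by field_simp

theorem exists_continuedFraction {e : ℕ → ℂ} {w : ℂ} {N : ℝ} (hN : 2 ≤ N) (hw : 2 * ‖w‖ ≤ N)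
    (he : ∀ k, 2 * N ≤ ‖e k‖) :
    ∃ T : ℕ → ℂ, ∀ k, T k * (e k - w * T (k + 1)) = 1 ∧ ‖T k‖ ≤ 1 / N := by
  have hN0 : 0 < N := by linarith
  let F : ℕ → ℕ → ℂ := fun m => Nat.rec (fun _ => 0) (fun _ f k => (e k - w * f (k + 1))⁻¹) m
  have hF1 : ∀ m k, F (m + 1) k = (e k - w * F m (k + 1))⁻¹ := fun m k => rfl
  have hFb : ∀ m k, ‖F m k‖ ≤ 1 / N := by
    intro m
    induction m with
    | zero => intro k; simp [F, hN0.le]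
    | succ m ih => intro k; rw [hF1]; exact (continuedFraction_step hN hw (he k) (ih _)).2
  have hF2 : ∀ m k, F (m + 1) k * (e k - w * F m (k + 1)) = 1 := fun m k => by
    rw [hF1]
    exact inv_mul_cancel₀ (continuedFraction_step hN hw (he k) (hFb m _)).1
  have hdist : ∀ m k, dist (F m k) (F (m + 1) k) ≤ 1 * (1 / 2) ^ m := by
    intro m
    induction m with
    | zero =>
      intro k
      have h1 := hFb 1 k
      have h2 : 1 / N ≤ 1 := by rw [div_le_one hN0]; linarith
      have h3 : F 0 k = 0 := rfl
      rw [h3, dist_zero_left]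
      simpa using h1.trans h2
    | succ m ih =>
      intro k
      rw [dist_eq_norm]
      refine (norm_sub_le_of_continuedFraction hN hw (hF2 m k) (hF2 (m + 1) k) (hFb (m + 1) k)
        (hFb (m + 2) k)).trans ?_
      have h1 := ih (k + 1)
      rw [dist_eq_norm] at h1
      rw [sub_self, norm_zero, zero_div, zero_add, pow_succ]
      rw [div_le_iff₀ hN0]
      have h2 : (0:ℝ) < (1 / 2) ^ m := by positivity
      nlinarith
  have hlim : ∀ k, ∃ t, Filter.Tendsto (fun m => F m k) Filter.atTop (nhds t) := fun k =>
    cauchySeq_tendsto_of_complete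
      (cauchySeq_of_le_geometric (1 / 2) 1 (by norm_num) fun m => hdist m k)
  choose T hT using hlim
  refine ⟨T, fun k => ⟨?_, ?_⟩⟩
  · have h1 : Filter.Tendsto (fun m => F (m + 1) k * (e k - w * F m (k + 1))) Filter.atTop
        (nhds (T k * (e k - w * T (k + 1)))) :=
      ((hT k).comp (Filter.tendsto_add_atTop_nat 1)).mul
        (((hT (k + 1)).const_mul w).const_sub (e k))
    simp only [hF2] at h1
    exact tendsto_nhds_unique h1 tendsto_const_nhds |>.symm ▸ rfl
  · exact le_of_tendsto' (hT k).norm fun m => hFb m k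

/-- A bounded solution of a diagonally dominant three-term recurrence on a half line is
minimal. -/
theorem bounded_solution_eq {e T v : ℕ → ℂ} {a b : ℂ} {N M : ℝ} (hN : 2 ≤ N)
    (ha : 2 * ‖a‖ ≤ N) (hT : ∀ k, T k * (e k - a * b * T (k + 1)) = 1 ∧ ‖T k‖ ≤ 1 / N)
    (hv : ∀ k, ‖v k‖ ≤ M) (h : ∀ k, e k * v (k + 1) + a * v (k + 2) + b * v k = 0) (k : ℕ) :
    v (k + 1) = -(b * T k * v k) := by
  have hN0 : 0 < N := by linarith
  have h1 : ∀ k, v (k + 1) + b * T k * v k = -(a * T k * (v (k + 2) + b * T (k + 1) * v (k + 1))) :=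
    fun k => by linear_combination (-v (k + 1)) * (hT k).1 + T k * h k
  have h2 : ‖v (k + 1) + b * T k * v k‖ ≤ 2 * 0 := by
    refine le_two_mul_of_le_add_half (x := fun k => ‖v (k + 1) + b * T k * v k‖)
      (M := M + ‖b‖ * (1 / N) * M) le_rfl (fun k => ?_) (fun k => ?_) k
    · refine (norm_add_le _ _).trans ?_
      rw [norm_mul, norm_mul]
      have := (hT k).2
      gcongr
      · exact hv _
      · exact hv _
    · change ‖v (k + 1) + b * T k * v k‖ ≤ 0 + ‖v (k + 2) + b * T (k + 1) * v (k + 1)‖ / 2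
      rw [h1, norm_neg, norm_mul]
      have := norm_mul_le_half hN0 ha (hT k).2
      have := norm_nonneg (v (k + 2) + b * T (k + 1) * v (k + 1))
      nlinarith
  rw [mul_zero] at h2
  have h3 := norm_le_zero_iff.1 h2
  linear_combination h3

theorem norm_continuedFraction_sub_le {e e' T T' : ℕ → ℂ} {w : ℂ} {N D : ℝ} (hN : 2 ≤ N)
    (hw : 2 * ‖w‖ ≤ N) (hT : ∀ k, T k * (e k - w * T (k + 1)) = 1 ∧ ‖T k‖ ≤ 1 / N)
    (hT' : ∀ k, T' k * (e' k - w * T' (k + 1)) = 1 ∧ ‖T' k‖ ≤ 1 / N)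
    (hD : ∀ k, ‖e k - e' k‖ ≤ D) (k : ℕ) : ‖T k - T' k‖ ≤ 2 * (D / N ^ 2) := by
  have hN0 : 0 < N := by linarith
  have hD0 : 0 ≤ D := (norm_nonneg _).trans (hD 0)
  refine le_two_mul_of_le_add_half (x := fun k => ‖T k - T' k‖) (M := 1 / N + 1 / N)
    (by positivity) (fun k => (norm_sub_le _ _).trans (add_le_add (hT k).2 (hT' k).2))
    (fun k => ?_) k
  refine (norm_sub_le_of_continuedFraction hN hw (hT k).1 (hT' k).1 (hT k).2 (hT' k).2).trans ?_
  gcongr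
  · exact hD k
  · exact div_le_self (by positivity) (by linarith)

/-! ### Reduction to a scalar equation -/

/-- The diagonal of the recurrence strictly between the two resonant indices `0` and `n`. -/
def midDiag (n : ℕ) (z : ℂ) (k : ℕ) : ℂ := 4 * k * (n - k) + z

/-- The diagonal of the recurrence outside the two resonant indices. -/
def outDiag (n : ℕ) (z : ℂ) (k : ℕ) : ℂ := 4 * (k + 1) * (n + k + 1) - z

/-- The continued fraction obtained by eliminating the indices `1, …, k`. -/
noncomputable def midFrac (w z : ℂ) (n : ℕ) : ℕ → ℂ
  | 0 => 0
  | k + 1 => (midDiag n z (k + 1) - w * midFrac w z n k)⁻¹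

theorem le_norm_outDiag {n : ℕ} {z : ℂ} (hn : 2 ≤ n) (hz : ‖z‖ ≤ 1) (k : ℕ) :
    2 * (n : ℝ) ≤ ‖outDiag n z k‖ := by
  have h1 : outDiag n z k = ((4 * (k + 1) * (n + k + 1) : ℝ) : ℂ) - z := by
    simp [outDiag]
  have h2 := norm_sub_norm_le ((4 * (k + 1) * (n + k + 1) : ℝ) : ℂ) z
  rw [Complex.norm_real, Real.norm_of_nonneg (by positivity)] at h2
  rw [h1]
  have h3 : (0:ℝ) ≤ k := by positivity
  have h4 : (2:ℝ) ≤ n := by exact_mod_cast hn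
  nlinarith [mul_nonneg h3 h3, mul_nonneg h3 (by linarith : (0:ℝ) ≤ n)]

theorem sub_one_le_mul_sub {n k : ℕ} (hk : 0 < k) (hkn : k < n) :
    (n : ℝ) - 1 ≤ k * (n - k) := by
  have h1 : (1:ℝ) ≤ k := by exact_mod_cast hk
  have h2 : (k:ℝ) + 1 ≤ n := by exact_mod_cast hkn
  nlinarith

theorem midFrac_spec {w z : ℂ} {n : ℕ} (hn : 2 ≤ n) (hw : 2 * ‖w‖ ≤ n) (hz : ‖z‖ ≤ 1) {k : ℕ}
    (hk : k + 1 < n) :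
    midFrac w z n (k + 1) * (midDiag n z (k + 1) - w * midFrac w z n k) = 1 ∧
      ‖midFrac w z n (k + 1)‖ ≤ 2 / (4 * ((k + 1 : ℕ) * (n - (k + 1 : ℕ)) : ℝ)) := by
  have hn' : (2:ℝ) ≤ n := by exact_mod_cast hn
  have hp := sub_one_le_mul_sub (Nat.succ_pos k) hk
  have hprev : ‖midFrac w z n k‖ ≤ 1 / n := by
    cases k with
    | zero => simp [midFrac]
    | succ j =>
      refine (midFrac_spec hn hw hz (by omega : j + 1 < n)).2.trans ?_
      have := sub_one_le_mul_sub (Nat.succ_pos j) (by omega : j + 1 < n)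
      rw [div_le_div_iff₀ (by linarith) (by linarith)]
      linarith
  set p : ℝ := (k + 1 : ℕ) * (n - (k + 1 : ℕ)) with hpdef
  have h1 := norm_mul_le_half (by linarith) hw hprev
  have h2 : midDiag n z (k + 1) = ((4 * p : ℝ) : ℂ) + z := by
    simp [midDiag, hpdef, mul_assoc]
  have h3 : 4 * p / 2 ≤ ‖midDiag n z (k + 1) - w * midFrac w z n k‖ := by
    have h4 := norm_sub_norm_le ((4 * p : ℝ) : ℂ) (-z + w * midFrac w z n k)
    rw [Complex.norm_real, Real.norm_of_nonneg (by linarith)] at h4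
    have h5 := norm_add_le (-z) (w * midFrac w z n k)
    rw [norm_neg] at h5
    rw [h2, show ((4 * p : ℝ) : ℂ) + z - w * midFrac w z n k
      = ((4 * p : ℝ) : ℂ) - (-z + w * midFrac w z n k) by ring]
    linarith
  have h4 : 0 < 4 * p / 2 := by linarith
  constructor
  · exact inv_mul_cancel₀ (norm_pos_iff.1 (h4.trans_le h3))
  · rw [midFrac, norm_inv, ← inv_div]
    exact inv_anti₀ h4 h3

theorem norm_midFrac_le {w z : ℂ} {n : ℕ} (hn : 2 ≤ n) (hw : 2 * ‖w‖ ≤ n) (hz : ‖z‖ ≤ 1) {k : ℕ}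
    (hk : k < n) : ‖midFrac w z n k‖ ≤ 1 / n := by
  have hn' : (2:ℝ) ≤ n := by exact_mod_cast hn
  cases k with
  | zero => simp [midFrac]
  | succ j =>
    refine (midFrac_spec hn hw hz hk).2.trans ?_
    have := sub_one_le_mul_sub (Nat.succ_pos j) hk
    rw [div_le_div_iff₀ (by linarith) (by linarith)]
    linarith

theorem norm_midFrac_sub_le {w z z' : ℂ} {n : ℕ} (hn : 2 ≤ n) (hw : 2 * ‖w‖ ≤ n) (hz : ‖z‖ ≤ 1)
    (hz' : ‖z'‖ ≤ 1) {k : ℕ} (hk : k < n) :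
    ‖midFrac w z n k - midFrac w z' n k‖ ≤ 2 * (‖z - z'‖ / (n : ℝ) ^ 2) := by
  have hn' : (2:ℝ) ≤ n := by exact_mod_cast hn
  induction k with
  | zero => simp only [midFrac, sub_self, norm_zero]; positivity
  | succ k ih =>
    have ih := ih (by omega)
    refine (norm_sub_le_of_continuedFraction hn' hw (midFrac_spec hn hw hz hk).1
      (midFrac_spec hn hw hz' hk).1 (norm_midFrac_le hn hw hz hk)
      (norm_midFrac_le hn hw hz' hk)).trans ?_
    have h1 : midDiag n z (k + 1) - midDiag n z' (k + 1) = z - z' := by simp [midDiag]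
    have h2 : ‖midFrac w z n k - midFrac w z' n k‖ / 2 / n
        ≤ ‖midFrac w z n k - midFrac w z' n k‖ / 2 :=
      div_le_self (by positivity) (by linarith)
    rw [h1]
    linarith

/-- The product of the continued fractions is the reciprocal of the tridiagonal determinant. -/
noncomputable def midProd (w z : ℂ) (n k : ℕ) : ℂ := ∏ i ∈ Finset.range k, midFrac w z n (i + 1)

theorem elimination {a b z : ℂ} {n : ℕ} {v : ℕ → ℂ} (hn : 2 ≤ n) (hw : 2 * ‖a * b‖ ≤ n)
    (hz : ‖z‖ ≤ 1)
    (h : ∀ k, k + 1 < n → midDiag n z (k + 1) * v (k + 1) = a * v (k + 2) + b * v k) {k : ℕ}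
    (hk : k < n) :
    v k = a * midFrac (a * b) z n k * v (k + 1) + b ^ k * midProd (a * b) z n k * v 0 := by
  induction k with
  | zero => simp [midFrac, midProd]
  | succ k ih =>
    have h1 := (midFrac_spec hn hw hz hk).1
    have h2 := h k hk
    have h3 := ih (by omega)
    rw [midProd, Finset.prod_range_succ, ← midProd]
    linear_combination (-v (k + 1)) * h1 + midFrac (a * b) z n (k + 1) * h2 +
      midFrac (a * b) z n (k + 1) * b * h3

theorem eq_zero_of_elimination {a b z : ℂ} {n : ℕ} {v : ℕ → ℂ} (hn : 2 ≤ n)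
    (hw : 2 * ‖a * b‖ ≤ n) (hz : ‖z‖ ≤ 1)
    (h : ∀ k, k + 1 < n → midDiag n z (k + 1) * v (k + 1) = a * v (k + 2) + b * v k)
    (h0 : v 0 = 0) (hn0 : v n = 0) {k : ℕ} (hk : k ≤ n) : v k = 0 := by
  obtain ⟨m, rfl⟩ := Nat.exists_eq_add_of_le hk
  clear hk
  induction m generalizing k with
  | zero => simpa using hn0
  | succ m ih =>
    have h1 : v (k + 1) = 0 := by
      have e : k + (m + 1) = k + 1 + m := by ring
      rw [e] at hn hw h hn0
      exact ih hn hw h hn0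
    rw [elimination hn hw hz h (by omega : k < k + (m + 1)), h1, h0]
    ring

/-- The scalar equation satisfied by an eigenvalue `n ^ 2 + z`. -/
theorem IsMathieuEig.scalar_equation {a b z : ℂ} {n : ℕ} {T : ℕ → ℂ} (hn : 2 ≤ n)
    (ha : 2 * ‖a‖ ≤ n) (hb : 2 * ‖b‖ ≤ n) (hw : 2 * ‖a * b‖ ≤ n) (hz : ‖z‖ ≤ 1)
    (hT : ∀ k, T k * (outDiag n z k - a * b * T (k + 1)) = 1 ∧ ‖T k‖ ≤ 1 / n)
    (h : IsMathieuEig a b (if Even n then 1 else -1) ((n : ℂ) ^ 2 + z)) :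
    (z - a * b * (midFrac (a * b) z n (n - 1) - T 0)) ^ 2 =
      (a * b) ^ n * midProd (a * b) z n (n - 1) ^ 2 := by
  have hn' : (2:ℝ) ≤ n := by exact_mod_cast hn
  obtain ⟨u, ⟨M, hM⟩, hne, hu⟩ := h.exists_recurrence
  have hba : b * a = a * b := mul_comm b a
  have hright := bounded_solution_eq (e := outDiag n z) (T := T) (v := fun k => u (n + k))
    (a := a) (b := b) hn' ha hT (fun k => hM _) (fun k => by
      have h1 := hu (n + (k + 1))
      have e1 : (n:ℤ) + (k + 1) + 1 = n + (k + 2) := by ring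
      have e2 : (n:ℤ) + (k + 1) - 1 = n + k := by ring
      rw [e1, e2] at h1
      rw [outDiag]
      push_cast at h1 ⊢
      linear_combination h1)
  have hleft := bounded_solution_eq (e := outDiag n z) (T := T) (v := fun k => u (-k))
    (a := b) (b := a) hn' hb (by rwa [hba]) (fun k => hM _) (fun k => by
      have h1 := hu (-(k + 1))
      have e1 : -((k:ℤ) + 1) + 1 = -k := by ring
      have e2 : -((k:ℤ) + 1) - 1 = -(k + 2) := by ring
      rw [e1, e2] at h1
      rw [outDiag]
      push_cast at h1 ⊢
      linear_combination h1)
  have hmid : ∀ k, k + 1 < n → midDiag n z (k + 1) * (fun k : ℕ => u k) (k + 1)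
      = a * (fun k : ℕ => u k) (k + 2) + b * (fun k : ℕ => u k) k := fun k hk => by
    have h1 := hu (k + 1)
    have e1 : (k:ℤ) + 1 + 1 = k + 2 := by ring
    have e2 : (k:ℤ) + 1 - 1 = k := by ring
    rw [e1, e2] at h1
    rw [midDiag]
    push_cast at h1 ⊢
    linear_combination -h1
  have hmid' : ∀ k, k + 1 < n → midDiag n z (k + 1) * (fun k : ℕ => u (n - k)) (k + 1)
      = b * (fun k : ℕ => u (n - k)) (k + 2) + a * (fun k : ℕ => u (n - k)) k := fun k hk => by
    have h1 := hu (n - (k + 1))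
    have e1 : (n:ℤ) - (k + 1) + 1 = n - k := by ring
    have e2 : (n:ℤ) - (k + 1) - 1 = n - (k + 2) := by ring
    rw [e1, e2] at h1
    rw [midDiag]
    push_cast at h1 ⊢
    linear_combination -h1
  obtain ⟨m, rfl⟩ : ∃ m, n = m + 1 := ⟨n - 1, by omega⟩
  have el1 := elimination (v := fun k : ℕ => u k) hn hw hz hmid (Nat.lt_succ_self m)
  have el2 := elimination (v := fun k : ℕ => u ((m + 1 : ℕ) - k)) hn (by rwa [hba]) hz hmid' (Nat.lt_succ_self m)
  rw [hba] at el2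
  have r0 := hright 0
  have l0 := hleft 0
  have hu0 := hu 0
  have hun := hu (m + 1 : ℕ)
  simp only [Nat.add_sub_cancel]
  set ρ := midFrac (a * b) z (m + 1) m
  set Q := midProd (a * b) z (m + 1) m
  have en : ((m + 1 : ℕ) : ℤ) - 1 = m := by push_cast; ring
  have en1 : ((m + 1 : ℕ) : ℤ) - (m + 1 : ℕ) = 0 := by ring
  have en2 : ((m + 1 : ℕ) : ℤ) - m = 0 + 1 := by push_cast; ring
  simp only [Nat.cast_zero, zero_add, neg_zero, add_zero, Nat.cast_one, sub_zero, en1, en2]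
    at r0 l0 el1 el2 hu0 hun
  rw [en, r0] at hun
  rw [zero_sub, l0] at hu0
  have E1 : (z - a * b * (ρ - T 0)) * u (m + 1 : ℕ) = b ^ (m + 1) * Q * u 0 := by
    push_cast at *
    linear_combination -hun + b * el1
  have E2 : (z - a * b * (ρ - T 0)) * u 0 = a ^ (m + 1) * Q * u (m + 1 : ℕ) := by
    push_cast at *
    linear_combination -hu0 + a * el2
  have hne' : u 0 ≠ 0 ∨ u (m + 1 : ℕ) ≠ 0 := by
    by_contra! hcon
    obtain ⟨j, hj⟩ := hne
    apply hj
    have hR : ∀ k : ℕ, u ((m + 1 : ℕ) + k) = 0 := by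
      intro k
      induction k with
      | zero => simpa using hcon.2
      | succ k ih => rw [hright k, ih]; ring
    have hL : ∀ k : ℕ, u (-k) = 0 := by
      intro k
      induction k with
      | zero => simpa using hcon.1
      | succ k ih => rw [hleft k, ih]; ring
    rcases le_total j 0 with h1 | h1
    · have h2 := hL (-j).toNat
      rwa [Int.toNat_of_nonneg (by omega), neg_neg] at h2
    · rcases le_total j (m + 1 : ℕ) with h2 | h2
      · have h3 := eq_zero_of_elimination (v := fun k : ℕ => u k) hn hw hz hmid (by simpa using hcon.1) hcon.2
          (k := j.toNat) (by omega)
        simpa [Int.toNat_of_nonneg h1] using h3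
      · have h3 := hR (j - (m + 1 : ℕ)).toNat
        rwa [Int.toNat_of_nonneg (by omega), add_sub_cancel] at h3
  rcases hne' with h1 | h1
  · refine mul_right_cancel₀ h1 ?_
    rw [mul_pow]
    linear_combination (z - a * b * (ρ - T 0)) * E2 + a ^ (m + 1) * Q * E1
  · refine mul_right_cancel₀ h1 ?_
    rw [mul_pow]
    linear_combination (z - a * b * (ρ - T 0)) * E1 + b ^ (m + 1) * Q * E2

/-! ### The finite product -/

theorem norm_prod_one_add_sub_le {x : ℕ → ℂ} (s : Finset ℕ) (h : ∑ i ∈ s, ‖x i‖ ≤ 1) :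
    ‖∏ i ∈ s, (1 + x i) - 1 - ∑ i ∈ s, x i‖ ≤ (∑ i ∈ s, ‖x i‖) ^ 2 := by
  have h1 : ‖∏ i ∈ s, (1 + x i) - 1 - ∑ i ∈ s, x i‖ ≤
      Real.exp (∑ i ∈ s, ‖x i‖) - 1 - ∑ i ∈ s, ‖x i‖ := by
    clear h
    induction s using Finset.induction_on with
    | empty => simp
    | insert j s hj ih =>
      rw [Finset.prod_insert hj, Finset.sum_insert hj, Finset.sum_insert hj, Real.exp_add]
      have h2 := s.norm_prod_one_add_sub_one_le x
      have e1 : (1 + x j) * ∏ i ∈ s, (1 + x i) - 1 - (x j + ∑ i ∈ s, x i) =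
          (∏ i ∈ s, (1 + x i) - 1 - ∑ i ∈ s, x i) + x j * (∏ i ∈ s, (1 + x i) - 1) := by ring
      rw [e1]
      refine (norm_add_le _ _).trans ?_
      rw [norm_mul]
      have h3 := mul_le_mul_of_nonneg_left h2 (norm_nonneg (x j))
      have h4 := mul_le_mul_of_nonneg_right (Real.add_one_le_exp ‖x j‖)
        (Real.exp_pos (∑ i ∈ s, ‖x i‖)).le
      linarith
  have h0 : 0 ≤ ∑ i ∈ s, ‖x i‖ := Finset.sum_nonneg fun i _ => norm_nonneg _
  have h3 := Real.abs_exp_sub_one_sub_id_le (x := ∑ i ∈ s, ‖x i‖) (by rwa [abs_of_nonneg h0])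
  have h4 := le_abs_self (Real.exp (∑ i ∈ s, ‖x i‖) - 1 - ∑ i ∈ s, ‖x i‖)
  linarith

theorem norm_prod_sub_prod_le_sum {f g : ℕ → ℂ} (s : Finset ℕ) (hf : ∀ i ∈ s, ‖f i‖ ≤ 1)
    (hg : ∀ i ∈ s, ‖g i‖ ≤ 1) :
    ‖∏ i ∈ s, f i - ∏ i ∈ s, g i‖ ≤ ∑ i ∈ s, ‖f i - g i‖ := by
  induction s using Finset.induction_on with
  | empty => simp
  | insert j s hj ih =>
    rw [Finset.prod_insert hj, Finset.sum_insert hj, Finset.prod_insert hj]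
    have ih := ih (fun i hi => hf i (Finset.mem_insert_of_mem hi))
      (fun i hi => hg i (Finset.mem_insert_of_mem hi))
    have h1 : ‖∏ i ∈ s, f i‖ ≤ 1 := by
      rw [norm_prod]
      exact Finset.prod_le_one (fun i _ => norm_nonneg _)
        fun i hi => hf i (Finset.mem_insert_of_mem hi)
    have h2 := hg j (Finset.mem_insert_self j s)
    rw [show f j * ∏ i ∈ s, f i - g j * ∏ i ∈ s, g i = (f j - g j) * ∏ i ∈ s, f i +
      g j * (∏ i ∈ s, f i - ∏ i ∈ s, g i) by ring]
    refine (norm_add_le _ _).trans ?_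
    rw [norm_mul, norm_mul]
    exact add_le_add (mul_le_of_le_one_right (norm_nonneg _) h1)
      ((mul_le_of_le_one_left (norm_nonneg _) h2).trans ih)

/-- The unperturbed diagonal entry at index `i + 1`. -/
def freeDiag (m i : ℕ) : ℝ := 4 * ((i + 1) * (m + 1 - i))

theorem le_freeDiag {m i : ℕ} (hi : i < m + 1) : 4 * ((m : ℝ) + 1) ≤ freeDiag m i := by
  have h1 : (i:ℝ) + 1 ≤ m + 1 := by exact_mod_cast hi
  have h2 : (0:ℝ) ≤ i := by positivity
  rw [freeDiag]
  nlinarith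

theorem freeDiag_pos {m i : ℕ} (hi : i < m + 1) : 0 < freeDiag m i :=
  lt_of_lt_of_le (by positivity) (le_freeDiag hi)

theorem sum_inv_freeDiag_le (m : ℕ) : ∑ i ∈ Finset.range (m + 1), (freeDiag m i)⁻¹ ≤ 1 / 4 := by
  have h1 : ∀ i ∈ Finset.range (m + 1), (freeDiag m i)⁻¹ ≤ (4 * ((m : ℝ) + 1))⁻¹ := fun i hi =>
    inv_anti₀ (by positivity) (le_freeDiag (Finset.mem_range.1 hi))
  refine (Finset.sum_le_card_nsmul _ _ _ h1).trans (le_of_eq ?_)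
  rw [Finset.card_range, nsmul_eq_mul]
  push_cast
  field_simp

theorem sum_inv_freeDiag_mul (m : ℕ) :
    16 * ((m + 1) * (m + 3)) * ∑ i ∈ Finset.range m, (freeDiag m i * freeDiag m (i + 1))⁻¹ =
      2 - 4 / ((m : ℝ) + 1) + 8 * ∑ i ∈ Finset.range (m + 1), (freeDiag m i)⁻¹ := by
  have h1 : ∀ i ∈ Finset.range m,
      16 * ((m + 1) * (m + 3)) * (freeDiag m i * freeDiag m (i + 1))⁻¹ =
      (-(((i + 1 : ℕ) : ℝ) + 1)⁻¹ - -((i : ℝ) + 1)⁻¹) +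
      (((m : ℝ) + 1 - (i + 1 : ℕ))⁻¹ - ((m : ℝ) + 1 - i)⁻¹) +
      4 * (freeDiag m i)⁻¹ + 4 * (freeDiag m (i + 1))⁻¹ := by
    intro i hi
    have h2 : (i:ℝ) + 1 ≤ m := by exact_mod_cast Finset.mem_range.1 hi
    have h3 : (m:ℝ) - i ≠ 0 := by intro h; linarith
    have h4 : (m:ℝ) + 1 - i ≠ 0 := by intro h; linarith
    have h5 : (i:ℝ) + 1 ≠ 0 := by positivity
    have h6 : (i:ℝ) + 1 + 1 ≠ 0 := by positivity
    simp only [freeDiag]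
    push_cast
    rw [show (m:ℝ) + 1 - (i + 1) = m - i by ring]
    field_simp
    ring
  rw [Finset.mul_sum, Finset.sum_congr rfl h1, Finset.sum_add_distrib, Finset.sum_add_distrib,
    Finset.sum_add_distrib, Finset.sum_range_sub (fun i : ℕ => -((i : ℝ) + 1)⁻¹),
    Finset.sum_range_sub (fun i : ℕ => ((m : ℝ) + 1 - i)⁻¹), ← Finset.mul_sum, ← Finset.mul_sum]
  have h2 := Finset.sum_range_succ (fun i => (freeDiag m i)⁻¹) m
  have h3 := Finset.sum_range_succ' (fun i => (freeDiag m i)⁻¹) m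
  have h4 : (freeDiag m m)⁻¹ = ((m : ℝ) + 1)⁻¹ / 4 := by
    rw [freeDiag]; field_simp; ring
  have h5 : (freeDiag m 0)⁻¹ = ((m : ℝ) + 1)⁻¹ / 4 := by
    rw [freeDiag]; push_cast; field_simp; ring
  rw [h4] at h2
  rw [h5] at h3
  rw [div_eq_mul_inv]
  simp only [Nat.cast_zero, zero_add, sub_zero, add_sub_cancel_left]
  linarith [inv_one (G := ℝ)]

theorem prod_freeDiag (m : ℕ) :
    ∏ i ∈ Finset.range (m + 1), freeDiag m i = 4 ^ (m + 1) * ((m + 1).factorial : ℝ) ^ 2 := by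
  simp only [freeDiag]
  rw [Finset.prod_mul_distrib, Finset.prod_const, Finset.card_range, Finset.prod_mul_distrib]
  have h1 : ∏ i ∈ Finset.range (m + 1), ((i : ℝ) + 1) = ((m + 1).factorial : ℝ) := by
    rw [← Finset.prod_range_add_one_eq_factorial]; push_cast; rfl
  have h2 : ∏ i ∈ Finset.range (m + 1), ((m : ℝ) + 1 - i) = ((m + 1).factorial : ℝ) := by
    rw [← h1, ← Finset.prod_range_reflect]
    refine Finset.prod_congr rfl fun i hi => ?_
    have := Finset.mem_range.1 hi
    rw [Nat.sub_sub, Nat.cast_sub (by omega)]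
    push_cast; ring
  rw [h1, h2]; ring

theorem abs_sum_inv_freeDiag_sub_le (m : ℕ) :
    |(∑ i ∈ Finset.range (m + 1), (freeDiag m i)⁻¹) / (2 * ((m : ℝ) + 2) ^ 2) -
      ∑ i ∈ Finset.range m, (freeDiag m i * freeDiag m (i + 1))⁻¹ -
      (-1 / (8 * ((m : ℝ) + 2) ^ 2) + 1 / (4 * ((m : ℝ) + 2) ^ 3))| ≤ 5 / ((m : ℝ) + 2) ^ 4 := by
  have h1 := sum_inv_freeDiag_mul m
  have h2 := sum_inv_freeDiag_le m
  have h3 : 0 ≤ ∑ i ∈ Finset.range (m + 1), (freeDiag m i)⁻¹ :=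
    Finset.sum_nonneg fun i hi => (inv_pos.2 (freeDiag_pos (Finset.mem_range.1 hi))).le
  set h := ∑ i ∈ Finset.range (m + 1), (freeDiag m i)⁻¹
  set S := ∑ i ∈ Finset.range m, (freeDiag m i * freeDiag m (i + 1))⁻¹
  have hS : S = (2 - 4 / ((m : ℝ) + 1) + 8 * h) / (16 * ((m + 1) * (m + 3))) := by
    rw [← h1]; field_simp
  have hm : (0:ℝ) ≤ m := by positivity
  have key : h / (2 * ((m : ℝ) + 2) ^ 2) - S -
      (-1 / (8 * ((m : ℝ) + 2) ^ 2) + 1 / (4 * ((m : ℝ) + 2) ^ 3)) =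
      -(h / 2 + 1 / 8) * (1 / (((m : ℝ) + 2) ^ 2 * ((m + 1) * (m + 3)))) +
      (((m : ℝ) + 2) ^ 2 + (m + 2) - 1) / (4 * (m + 2) ^ 3 * ((m + 1) * (m + 3)) * (m + 1)) := by
    rw [hS]
    field_simp
    ring
  have hA : 1 / (((m : ℝ) + 2) ^ 2 * ((m + 1) * (m + 3))) ≤ 2 / ((m : ℝ) + 2) ^ 4 := by
    rw [div_le_div_iff₀ (by positivity) (by positivity)]
    have : ((m:ℝ) + 2) ^ 2 ≤ 2 * ((m + 1) * (m + 3)) := by nlinarith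
    have h5 := mul_le_mul_of_nonneg_left this (by positivity : (0:ℝ) ≤ ((m:ℝ) + 2) ^ 2)
    linarith
  have hA0 : 0 ≤ 1 / (((m : ℝ) + 2) ^ 2 * ((m + 1) * (m + 3))) := by positivity
  have hB : (((m : ℝ) + 2) ^ 2 + (m + 2) - 1) / (4 * (m + 2) ^ 3 * ((m + 1) * (m + 3)) * (m + 1))
      ≤ 4 / ((m : ℝ) + 2) ^ 4 := by
    rw [div_le_div_iff₀ (by positivity) (by positivity)]
    have h5 : (((m : ℝ) + 2) ^ 2 + (m + 2) - 1) * (m + 2) ≤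
      16 * ((m + 1) * (m + 3) * (m + 1)) := by nlinarith [mul_nonneg hm hm, pow_nonneg hm 3]
    have h6 := mul_le_mul_of_nonneg_left h5 (by positivity : (0:ℝ) ≤ ((m:ℝ) + 2) ^ 3)
    linarith
  have hB0 : 0 ≤ (((m : ℝ) + 2) ^ 2 + (m + 2) - 1) /
      (4 * (m + 2) ^ 3 * ((m + 1) * (m + 3)) * (m + 1)) :=
    div_nonneg (by nlinarith) (by positivity)
  have h4 : 0 ≤ 1 / ((m : ℝ) + 2) ^ 4 := by positivity
  have e2 : 2 / ((m : ℝ) + 2) ^ 4 = 2 * (1 / ((m : ℝ) + 2) ^ 4) := by ring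
  have e4 : 4 / ((m : ℝ) + 2) ^ 4 = 4 * (1 / ((m : ℝ) + 2) ^ 4) := by ring
  have e5 : 5 / ((m : ℝ) + 2) ^ 4 = 5 * (1 / ((m : ℝ) + 2) ^ 4) := by ring
  have h7 := mul_le_mul_of_nonneg_right (by linarith : h / 2 + 1 / 8 ≤ 1 / 4) hA0
  have h8 := mul_nonneg (by linarith : 0 ≤ h / 2 + 1 / 8) hA0
  rw [key, abs_le]
  constructor <;> linarith

theorem midProd_asymptotics {w z : ℂ} {m : ℕ} {K : ℝ} (hw : 2 * ‖w‖ ≤ (m + 2 : ℕ)) (hz : ‖z‖ ≤ 1)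
    (hK0 : 0 ≤ K) (hz2 : ‖z‖ ≤ K / ((m : ℝ) + 2) ^ 2)
    (hz4 : ‖z - w / (2 * ((m : ℂ) + 2) ^ 2)‖ ≤ K / ((m : ℝ) + 2) ^ 4)
    (hK : K / 4 + 2 * ‖w‖ ≤ ((m : ℝ) + 2) ^ 2) :
    ∃ R : ℂ, 4 ^ (m + 1) * ((m + 1).factorial : ℂ) ^ 2 * midProd w z (m + 2) (m + 1) * R = 1 ∧
      ‖R - (1 - w / (8 * ((m : ℂ) + 2) ^ 2) + w / (4 * ((m : ℂ) + 2) ^ 3))‖ ≤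
        ((K / 4 + 2 * ‖w‖) ^ 2 + ‖w‖ * (K + ‖w‖) + K + 5 * ‖w‖) / ((m : ℝ) + 2) ^ 4 := by
  have hm : (0:ℝ) ≤ m := by positivity
  have hn : 2 ≤ m + 2 := by omega
  set W := ‖w‖ with hW
  have hW0 : 0 ≤ W := norm_nonneg w
  set N : ℝ := (m : ℝ) + 2 with hN
  have hN2 : 2 ≤ N := by linarith
  have hNcast : ((m + 2 : ℕ) : ℝ) = N := by push_cast; rfl
  set p : ℕ → ℝ := freeDiag m with hp
  have hppos : ∀ i, i < m + 1 → 0 < p i := fun i hi => freeDiag_pos hi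
  set ρ := midFrac w z (m + 2) with hρ
  have hρN : ∀ i, i < m + 1 → ‖ρ i‖ ≤ 1 / N := fun i hi => by
    rw [← hNcast]; exact norm_midFrac_le hn hw hz (by omega)
  have hρp : ∀ i, i < m + 1 → ‖ρ (i + 1)‖ ≤ 2 * (p i)⁻¹ := fun i hi => by
    refine (midFrac_spec hn hw hz (by omega : i + 1 < m + 2)).2.trans (le_of_eq ?_)
    rw [hp, freeDiag, div_eq_mul_inv]
    push_cast
    ring_nf
  have hρeq : ∀ i, i < m + 1 → ρ (i + 1) * ((p i : ℂ) + z - w * ρ i) = 1 := fun i hi => by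
    have h1 := (midFrac_spec hn hw hz (by omega : i + 1 < m + 2)).1
    rw [midDiag, ← hρ] at h1
    rw [hp, freeDiag]
    push_cast at h1 ⊢
    linear_combination h1
  set x : ℕ → ℂ := fun i => (z - w * ρ i) * (p i : ℂ)⁻¹ with hx
  set h := ∑ i ∈ Finset.range (m + 1), (p i)⁻¹ with hh
  set S := ∑ i ∈ Finset.range m, (p i * p (i + 1))⁻¹ with hSdef
  have hh4 : h ≤ 1 / 4 := sum_inv_freeDiag_le m
  have hh0 : 0 ≤ h := Finset.sum_nonneg fun i hi => (inv_pos.2 (hppos i (Finset.mem_range.1 hi))).le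
  have hS0 : 0 ≤ S := Finset.sum_nonneg fun i hi => by
    have := Finset.mem_range.1 hi
    have h1 := hppos i (by omega)
    have h2 := hppos (i + 1) (by omega)
    positivity
  have hS1 : S ≤ 1 / N ^ 2 := by
    have h1 := sum_inv_freeDiag_mul m
    have h2 : 0 ≤ 4 / ((m : ℝ) + 1) := by positivity
    have h3 : N ^ 2 ≤ 4 * ((m + 1) * (m + 3)) := by rw [hN]; nlinarith
    rw [le_div_iff₀ (by positivity)]
    have h4 := mul_le_mul_of_nonneg_left h3 hS0
    change 16 * ((m + 1) * (m + 3)) * S = 2 - 4 / ((m : ℝ) + 1) + 8 * h at h1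
    linarith
  refine ⟨∏ i ∈ Finset.range (m + 1), (1 + x i), ?_, ?_⟩
  · have h1 : (4 : ℂ) ^ (m + 1) * ((m + 1).factorial : ℂ) ^ 2 =
        ∏ i ∈ Finset.range (m + 1), (p i : ℂ) := by
      rw [← Complex.ofReal_prod, hp, prod_freeDiag]
      push_cast
      rfl
    rw [h1, midProd, ← Finset.prod_mul_distrib, ← Finset.prod_mul_distrib]
    refine Finset.prod_eq_one fun i hi => ?_
    have hi := Finset.mem_range.1 hi
    have h2 : (p i : ℂ) ≠ 0 := by exact_mod_cast (hppos i hi).ne'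
    rw [← hρ]
    simp only [hx]
    field_simp
    linear_combination hρeq i hi
  · have hsum : ∑ i ∈ Finset.range (m + 1), ‖x i‖ ≤ (K / 4 + 2 * W) / N ^ 2 := by
      have h1 : ∀ i ∈ Finset.range (m + 1), ‖x i‖ ≤ ‖z‖ * (p i)⁻¹ + W * (‖ρ i‖ * (p i)⁻¹) := by
        intro i hi
        have h2 := hppos i (Finset.mem_range.1 hi)
        rw [hx, norm_mul, norm_inv, Complex.norm_real, Real.norm_of_nonneg h2.le, ← mul_assoc,
          ← add_mul, hW, ← norm_mul]
        have := norm_sub_le z (w * ρ i)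
        gcongr
      have h2 : ∑ i ∈ Finset.range (m + 1), ‖ρ i‖ * (p i)⁻¹ ≤ 2 * S := by
        rw [Finset.sum_range_succ', hSdef, Finset.mul_sum]
        have h3 : ρ 0 = 0 := rfl
        rw [h3, norm_zero, zero_mul, add_zero]
        refine Finset.sum_le_sum fun i hi => ?_
        have hi := Finset.mem_range.1 hi
        have h4 := hppos (i + 1) (by omega)
        rw [mul_inv, ← mul_assoc]
        gcongr
        exact hρp i (by omega)
      refine (Finset.sum_le_sum h1).trans ?_
      rw [Finset.sum_add_distrib, ← Finset.mul_sum, ← Finset.mul_sum]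
      have h5 : ‖z‖ * h ≤ K / N ^ 2 * (1 / 4) := by gcongr
      have h6 : W * (2 * S) ≤ W * (2 * (1 / N ^ 2)) := by gcongr
      have h7 := mul_le_mul_of_nonneg_left h2 hW0
      have h8 : (K / 4 + 2 * W) / N ^ 2 = K / N ^ 2 * (1 / 4) + W * (2 * (1 / N ^ 2)) := by ring
      linarith
    have hsum0 : 0 ≤ ∑ i ∈ Finset.range (m + 1), ‖x i‖ :=
      Finset.sum_nonneg fun i _ => norm_nonneg _
    have hquad : ‖∏ i ∈ Finset.range (m + 1), (1 + x i) - 1 - ∑ i ∈ Finset.range (m + 1), x i‖ ≤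
        (K / 4 + 2 * W) ^ 2 / N ^ 4 := by
      refine (norm_prod_one_add_sub_le _ (hsum.trans ?_)).trans ?_
      · rw [div_le_one (by positivity)]; exact hK
      · calc _ ≤ ((K / 4 + 2 * W) / N ^ 2) ^ 2 := by gcongr
          _ = _ := by rw [div_pow]; ring
    have hlin : ∑ i ∈ Finset.range (m + 1), x i = z * (h : ℂ) -
        w * ∑ i ∈ Finset.range m, ρ (i + 1) * (p (i + 1) : ℂ)⁻¹ := by
      have h1 : ∑ i ∈ Finset.range (m + 1), x i =
          z * (∑ i ∈ Finset.range (m + 1), (p i : ℂ)⁻¹) -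
          w * ∑ i ∈ Finset.range (m + 1), ρ i * (p i : ℂ)⁻¹ := by
        rw [Finset.mul_sum, Finset.mul_sum, ← Finset.sum_sub_distrib]
        refine Finset.sum_congr rfl fun i _ => ?_
        rw [hx]; ring
      have h3 : ρ 0 = 0 := rfl
      rw [h1, Finset.sum_range_succ' (fun i => ρ i * (p i : ℂ)⁻¹), h3, hh]
      push_cast
      ring
    have hfirst : ‖∑ i ∈ Finset.range m, ρ (i + 1) * (p (i + 1) : ℂ)⁻¹ - (S : ℂ)‖ ≤
        (K + W) / N ^ 4 := by
      have h1 : (S : ℂ) = ∑ i ∈ Finset.range m, (p i : ℂ)⁻¹ * (p (i + 1) : ℂ)⁻¹ := by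
        rw [hSdef]; push_cast; simp only [mul_inv]
      rw [h1, ← Finset.sum_sub_distrib]
      have h2 : ∀ i ∈ Finset.range m, ‖ρ (i + 1) * (p (i + 1) : ℂ)⁻¹ -
          (p i : ℂ)⁻¹ * (p (i + 1) : ℂ)⁻¹‖ ≤ (K + W) / N ^ 2 * (p i * p (i + 1))⁻¹ := by
        intro i hi
        have hi := Finset.mem_range.1 hi
        have q1 := hppos i (by omega)
        have q2 := hppos (i + 1) (by omega)
        have q3 : (p i : ℂ) ≠ 0 := by exact_mod_cast q1.ne'
        have e1 : ρ (i + 1) - (p i : ℂ)⁻¹ = ρ (i + 1) * (p i : ℂ)⁻¹ * (w * ρ i - z) := by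
          have := hρeq i (by omega)
          field_simp
          linear_combination this
        have e2 : ‖w * ρ i - z‖ ≤ (K + W) / N := by
          refine (norm_sub_le _ _).trans ?_
          rw [norm_mul]
          have r1 := hρN i (by omega)
          have r2 : W * ‖ρ i‖ ≤ W * (1 / N) := by gcongr
          have r3 : K / N ^ 2 ≤ K / N := by
            gcongr
            nlinarith
          have r4 : (K + W) / N = K / N + W * (1 / N) := by ring
          linarith
        have e3 : (p i)⁻¹ ≤ 1 / (2 * N) := by
          rw [one_div]
          refine inv_anti₀ (by positivity) (le_trans ?_ (le_freeDiag (by omega : i < m + 1)))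
          linarith
        rw [← sub_mul, e1, norm_mul, norm_mul, norm_mul, norm_inv, norm_inv, Complex.norm_real,
          Complex.norm_real, Real.norm_of_nonneg q1.le, Real.norm_of_nonneg q2.le, mul_inv]
        calc ‖ρ (i + 1)‖ * (p i)⁻¹ * ‖w * ρ i - z‖ * (p (i + 1))⁻¹
            ≤ (2 * (p i)⁻¹) * (1 / (2 * N)) * ((K + W) / N) * (p (i + 1))⁻¹ := by
              have := hρp i (by omega)
              gcongr
          _ = _ := by field_simp
      refine (norm_sum_le _ _).trans ((Finset.sum_le_sum h2).trans ?_)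
      rw [← Finset.mul_sum]
      calc (K + W) / N ^ 2 * S ≤ (K + W) / N ^ 2 * (1 / N ^ 2) := by gcongr
        _ = _ := by rw [div_mul_div_comm]; ring
    have hreal := abs_sum_inv_freeDiag_sub_le m
    change |h / (2 * N ^ 2) - S - (-1 / (8 * N ^ 2) + 1 / (4 * N ^ 3))| ≤ 5 / N ^ 4 at hreal
    have hNc : (m : ℂ) + 2 = (N : ℂ) := by rw [hN]; push_cast; rfl
    rw [hNc] at hz4 ⊢
    have edecomp : ∏ i ∈ Finset.range (m + 1), (1 + x i) -
        (1 - w / (8 * (N : ℂ) ^ 2) + w / (4 * (N : ℂ) ^ 3)) =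
        (∏ i ∈ Finset.range (m + 1), (1 + x i) - 1 - ∑ i ∈ Finset.range (m + 1), x i) +
        -(w * (∑ i ∈ Finset.range m, ρ (i + 1) * (p (i + 1) : ℂ)⁻¹ - (S : ℂ))) +
        (z - w / (2 * (N : ℂ) ^ 2)) * (h : ℂ) +
        w * ((h / (2 * N ^ 2) - S - (-1 / (8 * N ^ 2) + 1 / (4 * N ^ 3)) : ℝ) : ℂ) := by
      rw [hlin]
      push_cast
      ring
    rw [edecomp]
    have t1 : ‖-(w * (∑ i ∈ Finset.range m, ρ (i + 1) * (p (i + 1) : ℂ)⁻¹ - (S : ℂ)))‖ ≤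
        W * ((K + W) / N ^ 4) := by
      rw [norm_neg, norm_mul]; gcongr
    have t2 : ‖(z - w / (2 * (N : ℂ) ^ 2)) * (h : ℂ)‖ ≤ K / N ^ 4 * 1 := by
      rw [norm_mul, Complex.norm_real, Real.norm_of_nonneg hh0]
      gcongr
      linarith
    have t3 : ‖w * ((h / (2 * N ^ 2) - S - (-1 / (8 * N ^ 2) + 1 / (4 * N ^ 3)) : ℝ) : ℂ)‖ ≤
        W * (5 / N ^ 4) := by
      rw [norm_mul, Complex.norm_real, Real.norm_eq_abs]; gcongr
    refine (norm_add₃_le.trans (add_le_add (add_le_add hquad t1) t2) |> fun q =>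
      (norm_add_le _ _).trans (add_le_add q t3)).trans (le_of_eq ?_)
    ring

/-! ### Orders of vanishing along a filter -/

/-- `f` is `O(ε ^ k)` along `l`. -/
def IsOrder {ι : Type*} (l : Filter ι) (ε : ι → ℂ) (k : ℕ) (f : ι → ℂ) : Prop :=
  f =O[l] fun i => ε i ^ k

namespace IsOrder

variable {ι : Type*} {l : Filter ι} {ε f g : ι → ℂ} {j k : ℕ}

theorem congr (hf : IsOrder l ε k f) (h : ∀ i, g i = f i) : IsOrder l ε k g := by
  rwa [funext h]

theorem add (hf : IsOrder l ε k f) (hg : IsOrder l ε k g) : IsOrder l ε k fun i => f i + g i :=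
  Asymptotics.IsBigO.add hf hg

theorem sub (hf : IsOrder l ε k f) (hg : IsOrder l ε k g) : IsOrder l ε k fun i => f i - g i :=
  Asymptotics.IsBigO.sub hf hg

theorem mul (hf : IsOrder l ε j f) (hg : IsOrder l ε k g) :
    IsOrder l ε (j + k) fun i => f i * g i := by
  simpa only [IsOrder, pow_add] using Asymptotics.IsBigO.mul hf hg

theorem const_mul (c : ℂ) (hf : IsOrder l ε k f) : IsOrder l ε k fun i => c * f i :=
  Asymptotics.IsBigO.const_mul_left hf c

theorem pow_self (k : ℕ) : IsOrder l ε k fun i => ε i ^ k :=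
  Asymptotics.isBigO_refl _ _

theorem const (c : ℂ) : IsOrder l ε 0 fun _ => c := by
  simpa [IsOrder] using Asymptotics.isBigO_const_const c (one_ne_zero (α := ℂ)) l

theorem mono (hε : Filter.Tendsto ε l (nhds 0)) (hf : IsOrder l ε k f) (h : j ≤ k) :
    IsOrder l ε j f := by
  refine Asymptotics.IsBigO.trans hf ?_
  obtain ⟨m, rfl⟩ := Nat.exists_eq_add_of_le h
  have h1 : (fun i => ε i ^ m) =O[l] fun _ => (1 : ℂ) := (hε.pow m).isBigO_one ℂ
  simpa [pow_add] using (Asymptotics.isBigO_refl (fun i => ε i ^ j) l).mul h1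

theorem tendsto_zero (hε : Filter.Tendsto ε l (nhds 0)) (hf : IsOrder l ε (k + 1) f) :
    Filter.Tendsto f l (nhds 0) := by
  refine Asymptotics.IsBigO.trans_tendsto hf ?_
  simpa using hε.pow (k + 1)

/-- Inversion of `1 + y` up to fourth order. -/
theorem inv {X G y : ι → ℂ} (hε : Filter.Tendsto ε l (nhds 0)) (hy : IsOrder l ε 2 y)
    (hX : IsOrder l ε 4 fun i => X i - (1 + y i)) (hG : ∀ i, G i = (X i)⁻¹) :
    IsOrder l ε 4 fun i => G i - (1 - y i) := by
  have hX1 : Filter.Tendsto X l (nhds 1) := by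
    have h := ((hX.tendsto_zero hε).add (hy.tendsto_zero hε)).add_const 1
    rw [add_zero, zero_add] at h
    exact h.congr fun i => by ring
  have hG0 : IsOrder l ε 0 G := by
    have := (hX1.inv₀ one_ne_zero).isBigO_one ℂ
    simpa [IsOrder, funext hG] using this
  have hne : ∀ᶠ i in l, X i ≠ 0 := hX1.eventually_ne one_ne_zero
  have h1 : IsOrder l ε 0 fun i => 1 - y i := (const 1).sub (hy.mono hε (by norm_num))
  have key := hG0.mul ((hy.mul hy).sub (h1.mul hX))
  refine Asymptotics.IsBigO.congr' key ?_ Filter.EventuallyEq.rfl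
  filter_upwards [hne] with i hi
  rw [hG i]
  field_simp
  ring

end IsOrder

section Resonance

variable {ι : Type*} {l : Filter ι} {ε ν z r₁ r₂ r₃ t₁ t₂ t₃ : ι → ℂ} {w : ℂ}

/-- The expansion in `ε = 1/n` of the innermost continued fraction. -/
theorem isOrder_midFrac_expansion (hε : Filter.Tendsto ε l (nhds 0)) (hν : ∀ i, ν i * ε i = 1)
    (hz : IsOrder l ε 2 z) (hr₁ : IsOrder l ε 1 r₁) (hr₂ : IsOrder l ε 1 r₂)
    (h₁ : ∀ i, r₁ i * (4 * (ν i - 1) + z i - w * r₂ i) = 1) :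
    IsOrder l ε 3 fun i => r₁ i - (ε i / 4 + ε i ^ 2 / 4) := by
  have e1 : IsOrder l ε 1 ε := (IsOrder.pow_self 1).congr (by simp)
  have hz1 := hz.mono hε (by norm_num : 1 ≤ 2)
  have s1 : IsOrder l ε 1 fun i => w * r₂ i - z i := (hr₂.const_mul w).sub hz1
  have s2 : IsOrder l ε 0 fun i => 4 + (w * r₂ i - z i) :=
    (IsOrder.const 4).add (s1.mono hε (by norm_num))
  have s3 : IsOrder l ε 2 fun i => r₁ i - ε i / 4 :=
    (((hr₁.mul e1).mul s2).const_mul (1 / 4)).congr fun i => by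
      linear_combination (ε i / 4) * h₁ i - r₁ i * hν i
  have s4 : IsOrder l ε 2 fun i => 4 * (r₁ i - ε i / 4) + r₁ i * (w * r₂ i - z i) :=
    (s3.const_mul 4).add (hr₁.mul s1)
  exact ((e1.mul s4).const_mul (1 / 4)).congr fun i => by
    linear_combination (ε i / 4) * h₁ i - r₁ i * hν i

/-- The expansion in `ε = 1/n` of the outermost continued fraction. -/
theorem isOrder_outFrac_expansion (hε : Filter.Tendsto ε l (nhds 0)) (hν : ∀ i, ν i * ε i = 1)
    (hz : IsOrder l ε 2 z) (ht₁ : IsOrder l ε 1 t₁) (ht₂ : IsOrder l ε 1 t₂)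
    (k₁ : ∀ i, t₁ i * (4 * (ν i + 1) - z i - w * t₂ i) = 1) :
    IsOrder l ε 3 fun i => t₁ i - (ε i / 4 - ε i ^ 2 / 4) := by
  have hε' : Filter.Tendsto (fun i => -ε i) l (nhds 0) := by simpa using hε.neg
  have conv : ∀ {k : ℕ} {f : ι → ℂ}, IsOrder l ε k f → IsOrder l (fun i => -ε i) k fun i => -f i := by
    intro k f hf
    refine Asymptotics.IsBigO.trans (Asymptotics.IsBigO.neg_left hf) ?_
    exact Asymptotics.IsBigO.of_bound 1 (Filter.Eventually.of_forall fun i => by simp)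
  have h := isOrder_midFrac_expansion (w := w) (ν := fun i => -ν i) hε'
    (fun i => by linear_combination hν i) (z := z)
    ((conv hz).const_mul (-1) |>.congr (by simp)) (conv ht₁) (conv ht₂)
    (fun i => by linear_combination k₁ i)
  refine Asymptotics.IsBigO.trans (Asymptotics.IsBigO.neg_left h) ?_ |>.congr_left (fun i => by ring)
  exact Asymptotics.IsBigO.of_bound 1 (Filter.Eventually.of_forall fun i => by simp)

/-- The resonance equation determines `z = λ - n²` up to `O(n⁻⁴)`. -/
theorem isOrder_resonance (hε : Filter.Tendsto ε l (nhds 0)) (hν : ∀ i, ν i * ε i = 1)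
    (hz : IsOrder l ε 0 z) (hr₁ : IsOrder l ε 1 r₁) (hr₂ : IsOrder l ε 1 r₂)
    (hr₃ : IsOrder l ε 1 r₃) (ht₁ : IsOrder l ε 1 t₁) (ht₂ : IsOrder l ε 1 t₂)
    (ht₃ : IsOrder l ε 1 t₃)
    (h₁ : ∀ i, r₁ i * (4 * (ν i - 1) + z i - w * r₂ i) = 1)
    (h₂ : ∀ i, r₂ i * (8 * (ν i - 2) + z i - w * r₃ i) = 1)
    (k₁ : ∀ i, t₁ i * (4 * (ν i + 1) - z i - w * t₂ i) = 1)
    (k₂ : ∀ i, t₂ i * (8 * (ν i + 2) - z i - w * t₃ i) = 1)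
    (hE : IsOrder l ε 4 fun i => z i - w * (r₁ i - t₁ i)) :
    IsOrder l ε 2 z ∧ IsOrder l ε 4 fun i => z i - w * ε i ^ 2 / 2 := by
  have low : ∀ {f : ι → ℂ}, IsOrder l ε 1 f → IsOrder l ε 0 f := fun h => h.mono hε (by norm_num)
  have d1 : IsOrder l ε 2 fun i => r₁ i - t₁ i :=
    ((hr₁.mul ht₁).mul (((IsOrder.const 8).sub (hz.const_mul 2)).add
      (((low hr₂).const_mul w).sub ((low ht₂).const_mul w)))).congr fun i => by
        linear_combination (-r₁ i) * k₁ i + t₁ i * h₁ i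
  have hz2 : IsOrder l ε 2 z :=
    ((hE.mono hε (by norm_num : 2 ≤ 4)).add (d1.const_mul w)).congr fun i => by ring
  have d2 : IsOrder l ε 2 fun i => r₂ i - t₂ i :=
    ((hr₂.mul ht₂).mul (((IsOrder.const 32).sub (hz.const_mul 2)).add
      (((low hr₃).const_mul w).sub ((low ht₃).const_mul w)))).congr fun i => by
        linear_combination (-r₂ i) * k₂ i + t₂ i * h₂ i
  have er := isOrder_midFrac_expansion hε hν hz2 hr₁ hr₂ h₁
  have et := isOrder_outFrac_expansion hε hν hz2 ht₁ ht₂ k₁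
  have e1 : IsOrder l ε 1 ε := (IsOrder.pow_self 1).congr (by simp)
  have u1 : IsOrder l ε 1 fun i => 1 / 4 * ε i + 1 / 4 * ε i ^ 2 :=
    (e1.const_mul (1 / 4)).add
      (((IsOrder.pow_self 2).mono hε (by norm_num : 1 ≤ 2)).const_mul (1 / 4))
  have p1 : IsOrder l ε 4 fun i => r₁ i * t₁ i - ε i ^ 2 / 16 :=
    (((er.mul ht₁).add (u1.mul et)).sub ((IsOrder.pow_self 4).const_mul (1 / 16))).congr
      fun i => by ring
  refine ⟨hz2, ?_⟩
  exact ((hE.add (((hr₁.mul ht₁).mul ((d2.const_mul w).sub (hz2.const_mul 2))).const_mul w)).add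
    (p1.const_mul (8 * w))).congr fun i => by
      linear_combination w * ((-r₁ i) * k₁ i + t₁ i * h₁ i)

end Resonance

/-- The slope of the resonance function, up to fourth order. -/
theorem isOrder_slope {ι : Type*} {l : Filter ι} {ε A q s r r' t t' : ι → ℂ} {w : ℂ}
    (hε : Filter.Tendsto ε l (nhds 0))
    (hr : IsOrder l ε 1 r) (hr' : IsOrder l ε 1 r') (ht : IsOrder l ε 1 t)
    (ht' : IsOrder l ε 1 t') (hq : IsOrder l ε 2 q) (hs : IsOrder l ε 2 s)
    (er : IsOrder l ε 3 fun i => r i - (ε i / 4 + ε i ^ 2 / 4))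
    (er' : IsOrder l ε 3 fun i => r' i - (ε i / 4 + ε i ^ 2 / 4))
    (et : IsOrder l ε 3 fun i => t i - (ε i / 4 - ε i ^ 2 / 4))
    (et' : IsOrder l ε 3 fun i => t' i - (ε i / 4 - ε i ^ 2 / 4))
    (hA : ∀ i, A i = w * (r i * r' i * (w * q i - 1) - t i * t' i * (1 + w * s i))) :
    IsOrder l ε 4 fun i => A i + w * ε i ^ 2 / 8 := by
  have e1 : IsOrder l ε 1 ε := (IsOrder.pow_self 1).congr (by simp)
  have e2 : IsOrder l ε 1 fun i => ε i ^ 2 := (IsOrder.pow_self 2).mono hε (by norm_num)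
  have u1 : IsOrder l ε 1 fun i => 1 / 4 * ε i + 1 / 4 * ε i ^ 2 :=
    (e1.const_mul (1 / 4)).add (e2.const_mul (1 / 4))
  have v1 : IsOrder l ε 1 fun i => 1 / 4 * ε i - 1 / 4 * ε i ^ 2 :=
    (e1.const_mul (1 / 4)).sub (e2.const_mul (1 / 4))
  have p1 := ((er.mul hr').add (u1.mul er')).add ((et.mul ht').add (v1.mul et'))
  have p2 := (p1.add ((IsOrder.pow_self 4).const_mul (1 / 8))).const_mul (-w)
  have p3 := (((hr.mul hr').mul hq).sub ((ht.mul ht').mul hs)).const_mul (w ^ 2)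
  exact (p2.add p3).congr fun i => by rw [hA i]; ring

/-- Combination of the expansions of the off-diagonal products and of the slope. -/
theorem isOrder_sq_expansion {ι : Type*} {l : Filter ι} {ε A G G' H : ι → ℂ} {w : ℂ}
    (hε : Filter.Tendsto ε l (nhds 0))
    (hA : IsOrder l ε 4 fun i => A i + w * ε i ^ 2 / 8)
    (hG : IsOrder l ε 4 fun i => G i - (1 + w * ε i ^ 2 / 8 - w * ε i ^ 3 / 4))
    (hG' : IsOrder l ε 4 fun i => G' i - (1 + w * ε i ^ 2 / 8 - w * ε i ^ 3 / 4))
    (hH : ∀ i, H i = (G i + G' i) / 2 * (1 - A i)⁻¹) :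
    IsOrder l ε 4 fun i => H i ^ 2 - (1 - w * ε i ^ 3 / 2) := by
  have x2 : IsOrder l ε 2 fun i => w / 8 * ε i ^ 2 := (IsOrder.pow_self 2).const_mul _
  have y3 : IsOrder l ε 3 fun i => w / 4 * ε i ^ 3 := (IsOrder.pow_self 3).const_mul _
  have y2 := y3.mono hε (by norm_num : 2 ≤ 3)
  have hB : IsOrder l ε 4 fun i => (1 - A i)⁻¹ - (1 - w / 8 * ε i ^ 2) :=
    IsOrder.inv hε x2 ((hA.const_mul (-1)).congr fun i => by ring) fun i => rfl
  have hB0 : IsOrder l ε 0 fun i => (1 - A i)⁻¹ :=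
    ((hB.mono hε (by norm_num : 0 ≤ 4)).add
      ((IsOrder.const 1).sub (x2.mono hε (by norm_num : 0 ≤ 2)))).congr fun i => by ring
  have hg : IsOrder l ε 4 fun i => (G i + G' i) / 2 - (1 + w / 8 * ε i ^ 2 - w / 4 * ε i ^ 3) :=
    ((hG.add hG').const_mul (1 / 2)).congr fun i => by ring
  have g0 : IsOrder l ε 0 fun i => 1 + (w / 8 * ε i ^ 2 - w / 4 * ε i ^ 3) :=
    (IsOrder.const 1).add ((x2.sub y2).mono hε (by norm_num))
  have h1 : IsOrder l ε 4 fun i => H i - (1 - w / 4 * ε i ^ 3) :=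
    (((hg.mul hB0).add (g0.mul hB)).add (x2.mul (y2.sub x2))).congr fun i => by
      rw [hH i]; ring
  have y0 : IsOrder l ε 0 fun i => 1 - w / 4 * ε i ^ 3 :=
    (IsOrder.const 1).sub (y3.mono hε (by norm_num))
  have h2 : IsOrder l ε 0 fun i => (H i - (1 - w / 4 * ε i ^ 3)) + 2 * (1 - w / 4 * ε i ^ 3) :=
    (h1.mono hε (by norm_num)).add (y0.const_mul 2)
  exact ((h1.mul h2).add (y2.mul y2)).congr fun i => by ring

/-! ### Splitting of a pair of eigenvalues -/

theorem pow_mul_midProd (c w z : ℂ) {n : ℕ} (hn : 1 ≤ n) :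
    c ^ n * midProd w z n (n - 1) =
      c * ∏ i ∈ Finset.range (n - 1), (c * midFrac w z n (i + 1)) := by
  obtain ⟨m, rfl⟩ := Nat.exists_eq_add_of_le' hn
  rw [Finset.prod_mul_distrib, Finset.prod_const, Finset.card_range, midProd, pow_succ]
  simp only [Nat.add_sub_cancel]
  ring

theorem norm_mul_midFrac_le {c w z : ℂ} {n : ℕ} (hn : 2 ≤ n) (hw : 2 * ‖w‖ ≤ n) (hz : ‖z‖ ≤ 1)
    {k : ℕ} (hk : k < n) : ‖c * midFrac w z n k‖ ≤ ‖c‖ / n := by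
  rw [norm_mul, div_eq_mul_one_div]
  exact mul_le_mul_of_nonneg_left (norm_midFrac_le hn hw hz hk) (norm_nonneg _)

theorem norm_pow_mul_midProd_le {c w z : ℂ} {n : ℕ} (hn : 5 ≤ n) (hw : 2 * ‖w‖ ≤ n)
    (hc : ‖c‖ ≤ n) (hz : ‖z‖ ≤ 1) :
    ‖c ^ n * midProd w z n (n - 1)‖ ≤ ‖c‖ * (‖c‖ / n) ^ 4 := by
  have hn0 : (0 : ℝ) < n := by exact_mod_cast (by omega : 0 < n)
  rw [pow_mul_midProd c w z (by omega), norm_mul, norm_prod]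
  refine mul_le_mul_of_nonneg_left ?_ (norm_nonneg _)
  calc ∏ i ∈ Finset.range (n - 1), ‖c * midFrac w z n (i + 1)‖
      ≤ ∏ i ∈ Finset.range (n - 1), ‖c‖ / n :=
        Finset.prod_le_prod (fun _ _ => norm_nonneg _) fun i hi =>
          norm_mul_midFrac_le (by omega) hw hz (by have := Finset.mem_range.1 hi; omega)
    _ = (‖c‖ / n) ^ (n - 1) := by rw [Finset.prod_const, Finset.card_range]
    _ ≤ (‖c‖ / n) ^ 4 :=
        pow_le_pow_of_le_one (by positivity) ((div_le_one hn0).2 hc) (by omega)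

theorem norm_pow_mul_midProd_sub_le {c w z z' : ℂ} {n : ℕ} (hn : 2 ≤ n) (hcw : c ^ 2 = w)
    (hw : 8 * ‖w‖ ≤ n) (hc : ‖c‖ ≤ n) (hz : ‖z‖ ≤ 1) (hz' : ‖z'‖ ≤ 1) :
    ‖c ^ n * midProd w z n (n - 1) - c ^ n * midProd w z' n (n - 1)‖ ≤ ‖z - z'‖ / 4 := by
  have hn0 : (0 : ℝ) < n := by exact_mod_cast (by omega : 0 < n)
  have hw2 : 2 * ‖w‖ ≤ n := by linarith [norm_nonneg w]
  have hle : ∀ {x : ℂ}, ‖x‖ ≤ 1 → ∀ i ∈ Finset.range (n - 1), ‖c * midFrac w x n (i + 1)‖ ≤ 1 :=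
    fun hx i hi => (norm_mul_midFrac_le hn hw2 hx
      (by have := Finset.mem_range.1 hi; omega)).trans ((div_le_one hn0).2 hc)
  rw [pow_mul_midProd c w z (by omega), pow_mul_midProd c w z' (by omega), ← mul_sub, norm_mul]
  have h1 : ‖∏ i ∈ Finset.range (n - 1), (c * midFrac w z n (i + 1)) -
      ∏ i ∈ Finset.range (n - 1), (c * midFrac w z' n (i + 1))‖ ≤
      n * (‖c‖ * (2 * (‖z - z'‖ / (n : ℝ) ^ 2))) := by
    refine (norm_prod_sub_prod_le_sum _ (hle hz) (hle hz')).trans ?_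
    refine (Finset.sum_le_card_nsmul _ _ (‖c‖ * (2 * (‖z - z'‖ / (n : ℝ) ^ 2))) ?_).trans ?_
    · intro i hi
      rw [← mul_sub, norm_mul]
      exact mul_le_mul_of_nonneg_left (norm_midFrac_sub_le hn hw2 hz hz'
        (by have := Finset.mem_range.1 hi; omega)) (norm_nonneg _)
    · rw [Finset.card_range, nsmul_eq_mul]
      refine mul_le_mul_of_nonneg_right ?_ (by positivity)
      exact_mod_cast Nat.sub_le n 1
  have hcn : ‖c‖ * ‖c‖ = ‖w‖ := by rw [← hcw, norm_pow, sq]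
  calc _ ≤ ‖c‖ * (n * (‖c‖ * (2 * (‖z - z'‖ / (n : ℝ) ^ 2)))) :=
        mul_le_mul_of_nonneg_left h1 (norm_nonneg _)
    _ = (8 * ‖w‖) / n * (‖z - z'‖ / 4) := by
        rw [← hcn]; field_simp; ring
    _ ≤ 1 * (‖z - z'‖ / 4) :=
        mul_le_mul_of_nonneg_right ((div_le_one hn0).2 hw) (by positivity)
    _ = ‖z - z'‖ / 4 := one_mul _

/-- Two distinct solutions of `(z - α(z))² = E(z)²` with `α` and `E` contracting belong to
opposite signs of the square root. -/
theorem sq_sub_eq_of_contracting {z z' α α' E E' : ℂ} (hne : z ≠ z') (h : (z - α) ^ 2 = E ^ 2)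
    (h' : (z' - α') ^ 2 = E' ^ 2) (hα : ‖α - α'‖ ≤ ‖z - z'‖ / 4) (hE : ‖E - E'‖ ≤ ‖z - z'‖ / 4) :
    ((z - z') - (α - α')) ^ 2 = (E + E') ^ 2 := by
  have hpos : 0 < ‖z - z'‖ := norm_pos_iff.2 (sub_ne_zero.2 hne)
  have contra : ∀ x : ℂ, ‖x‖ ≤ ‖z - z'‖ / 4 → z - z' ≠ (α - α') + x := by
    intro x hx heq
    have := norm_add_le (α - α') x
    rw [← heq] at this
    linarith
  rcases sq_eq_sq_iff_eq_or_eq_neg.1 h with h1 | h1 <;>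
    rcases sq_eq_sq_iff_eq_or_eq_neg.1 h' with h2 | h2
  · exact absurd (by linear_combination h1 - h2) (contra _ hE)
  · have : z - z' - (α - α') = E + E' := by linear_combination h1 - h2
    rw [this]
  · have : z - z' - (α - α') = -(E + E') := by linear_combination h1 - h2
    rw [this, neg_sq]
  · exact absurd (by linear_combination h1 - h2) (contra (-(E - E')) (by rwa [norm_neg]))

/-- `z = λ - n²` solves the scalar equation for an eigenvalue `λ` close to `n²`, where `T` is the
continued fraction of the outer indices. -/
structure IsResonant (w : ℂ) (n : ℕ) (z : ℂ) (T : ℕ → ℂ) : Prop where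
  norm_le : ‖z‖ ≤ 1
  outFrac : ∀ k, T k * (outDiag n z k - w * T (k + 1)) = 1 ∧ ‖T k‖ ≤ 1 / n
  scalar_equation : (z - w * (midFrac w z n (n - 1) - T 0)) ^ 2 = w ^ n * midProd w z n (n - 1) ^ 2

/-- The product of the continued fractions, normalised by its value at `w = z = 0`. -/
noncomputable def normProd (w z : ℂ) (n : ℕ) : ℂ :=
  4 ^ (n - 1) * ((n - 1).factorial : ℂ) ^ 2 * midProd w z n (n - 1)

theorem norm_inv_normProd_sub_le {w z : ℂ} {n : ℕ} {K : ℝ} (hn : 2 ≤ n) (hw : 2 * ‖w‖ ≤ n)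
    (hz : ‖z‖ ≤ 1) (hK0 : 0 ≤ K) (hz2 : ‖z‖ ≤ K / (n : ℝ) ^ 2)
    (hz4 : ‖z - w / (2 * (n : ℂ) ^ 2)‖ ≤ K / (n : ℝ) ^ 4) (hK : K / 4 + 2 * ‖w‖ ≤ (n : ℝ) ^ 2) :
    ‖(normProd w z n)⁻¹ - (1 - w / (8 * (n : ℂ) ^ 2) + w / (4 * (n : ℂ) ^ 3))‖ ≤
      ((K / 4 + 2 * ‖w‖) ^ 2 + ‖w‖ * (K + ‖w‖) + K + 5 * ‖w‖) / (n : ℝ) ^ 4 := by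
  obtain ⟨m, rfl⟩ := Nat.exists_eq_add_of_le' hn
  push_cast at hz2 hz4 hK ⊢
  obtain ⟨R, hR, hR'⟩ := midProd_asymptotics hw hz hK0 hz2 hz4 hK
  have : (normProd w z (m + 2))⁻¹ = R := inv_eq_of_mul_eq_one_right hR
  rwa [this]

section Family

variable {ι : Type*} {l : Filter ι} {n : ι → ℕ} {z : ι → ℂ} {T : ι → ℕ → ℂ} {w c : ℂ}

theorem isOrder_one_of_norm_le {f : ι → ℂ} (hf : ∀ i, ‖f i‖ ≤ 1 / n i) :
    IsOrder l (fun i => 1 / (n i : ℂ)) 1 f :=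
  Asymptotics.IsBigO.of_bound 1 (Filter.Eventually.of_forall fun i => by simpa using hf i)

theorem tendsto_one_div_natCast (hl : Filter.Tendsto n l Filter.atTop) :
    Filter.Tendsto (fun i => 1 / (n i : ℂ)) l (nhds 0) := by
  have := (tendsto_one_div_atTop_nhds_zero_nat (𝕜 := ℂ)).comp hl
  exact this

theorem isOrder_normProd (hl : Filter.Tendsto n l Filter.atTop) (hn : ∀ i, 5 ≤ n i)
    (hw : ∀ i, 8 * ‖w‖ ≤ n i) (hz : ∀ i, ‖z i‖ ≤ 1)
    (hz2 : IsOrder l (fun i => 1 / (n i : ℂ)) 2 z)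
    (hz4 : IsOrder l (fun i => 1 / (n i : ℂ)) 4 fun i => z i - w * (1 / (n i : ℂ)) ^ 2 / 2) :
    IsOrder l (fun i => 1 / (n i : ℂ)) 4 fun i =>
      normProd w (z i) (n i) - (1 + w * (1 / (n i : ℂ)) ^ 2 / 8 - w * (1 / (n i : ℂ)) ^ 3 / 4) := by
  have hε := tendsto_one_div_natCast hl
  obtain ⟨K₂, hK₂⟩ := Asymptotics.IsBigO.bound hz2
  obtain ⟨K₄, hK₄⟩ := Asymptotics.IsBigO.bound hz4
  set K := max 0 (max K₂ K₄)
  have hbig : ∀ᶠ i in l, K / 4 + 2 * ‖w‖ ≤ (n i : ℝ) ^ 2 :=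
    ((Filter.tendsto_pow_atTop two_ne_zero).comp
      (tendsto_natCast_atTop_atTop.comp hl)).eventually_ge_atTop _
  have hinv : IsOrder l (fun i => 1 / (n i : ℂ)) 4 fun i => (normProd w (z i) (n i))⁻¹ -
      (1 + (w / 4 * (1 / (n i : ℂ)) ^ 3 - w / 8 * (1 / (n i : ℂ)) ^ 2)) := by
    refine Asymptotics.IsBigO.of_bound
      ((K / 4 + 2 * ‖w‖) ^ 2 + ‖w‖ * (K + ‖w‖) + K + 5 * ‖w‖) ?_
    filter_upwards [hK₂, hK₄, hbig] with i h2 h4 hb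
    have hw2 : 2 * ‖w‖ ≤ n i := by linarith [hw i, norm_nonneg w]
    have hn2 : 2 ≤ n i := by linarith [hn i]
    have hn0 : (n i : ℂ) ≠ 0 := by exact_mod_cast (by omega : n i ≠ 0)
    have h := norm_inv_normProd_sub_le (K := K) hn2 hw2 (hz i) (le_max_left _ _) ?_ ?_ hb
    · convert h using 2
      · field_simp
        ring
      · simp [div_eq_mul_inv]
    · refine h2.trans ?_
      rw [norm_pow, norm_div, norm_one, Complex.norm_natCast, one_div, inv_pow, ← div_eq_mul_inv]
      gcongr
      exact (le_max_left _ _).trans (le_max_right _ _)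
    · have e : z i - w / (2 * (n i : ℂ) ^ 2) = z i - w * (1 / (n i : ℂ)) ^ 2 / 2 := by
        field_simp
      rw [e]
      refine h4.trans ?_
      rw [norm_pow, norm_div, norm_one, Complex.norm_natCast, one_div, inv_pow, ← div_eq_mul_inv]
      gcongr
      exact (le_max_right _ _).trans (le_max_right _ _)
  have y2 : IsOrder l (fun i => 1 / (n i : ℂ)) 2 fun i =>
      w / 4 * (1 / (n i : ℂ)) ^ 3 - w / 8 * (1 / (n i : ℂ)) ^ 2 :=
    (((IsOrder.pow_self 3).mono hε (by norm_num)).const_mul _).sub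
      ((IsOrder.pow_self 2).const_mul _)
  exact (IsOrder.inv hε y2 hinv fun i => (inv_inv _).symm).congr fun i => by ring

theorem IsResonant.isOrder (hl : Filter.Tendsto n l Filter.atTop) (hn : ∀ i, 5 ≤ n i)
    (hw : ∀ i, 8 * ‖w‖ ≤ n i) (hc : ∀ i, ‖c‖ ≤ n i) (hcw : c ^ 2 = w)
    (h : ∀ i, IsResonant w (n i) (z i) (T i)) :
    (IsOrder l (fun i => 1 / (n i : ℂ)) 3 fun i => midFrac w (z i) (n i) (n i - 1) -
        (1 / (n i : ℂ) / 4 + (1 / (n i : ℂ)) ^ 2 / 4)) ∧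
      (IsOrder l (fun i => 1 / (n i : ℂ)) 3 fun i => T i 0 -
        (1 / (n i : ℂ) / 4 - (1 / (n i : ℂ)) ^ 2 / 4)) ∧
      IsOrder l (fun i => 1 / (n i : ℂ)) 4 fun i => normProd w (z i) (n i) -
        (1 + w * (1 / (n i : ℂ)) ^ 2 / 8 - w * (1 / (n i : ℂ)) ^ 3 / 4) := by
  have hε := tendsto_one_div_natCast hl
  have hν : ∀ i, (n i : ℂ) * (1 / (n i : ℂ)) = 1 := fun i =>
    mul_one_div_cancel (by exact_mod_cast (by have := hn i; omega : n i ≠ 0))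
  have hw2 : ∀ i, 2 * ‖w‖ ≤ n i := fun i => by linarith [hw i, norm_nonneg w]
  have hn2 : ∀ i, 2 ≤ n i := fun i => by linarith [hn i]
  have hz : ∀ i, ‖z i‖ ≤ 1 := fun i => (h i).norm_le
  have hr : ∀ j, 1 ≤ j → IsOrder l (fun i => 1 / (n i : ℂ)) 1
      fun i => midFrac w (z i) (n i) (n i - j) := fun j hj =>
    isOrder_one_of_norm_le fun i =>
      norm_midFrac_le (hn2 i) (hw2 i) (hz i) (by have := hn i; omega)
  have ht : ∀ j, IsOrder l (fun i => 1 / (n i : ℂ)) 1 fun i => T i j := fun j =>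
    isOrder_one_of_norm_le fun i => ((h i).outFrac j).2
  have hr_eq : ∀ j, 1 ≤ j → j ≤ 2 → ∀ i, midFrac w (z i) (n i) (n i - j) *
      (4 * j * (n i - j) + z i - w * midFrac w (z i) (n i) (n i - (j + 1))) = 1 := by
    intro j hj hj2 i
    have h5 := hn i
    have h1 := (midFrac_spec (hn2 i) (hw2 i) (hz i) (by omega : n i - (j + 1) + 1 < n i)).1
    have e : n i - (j + 1) + 1 = n i - j := by omega
    rw [e, midDiag, Nat.cast_sub (by omega)] at h1
    linear_combination h1
  have ht_eq : ∀ j i, T i j * (4 * (j + 1) * (n i + j + 1) - z i - w * T i (j + 1)) = 1 :=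
    fun j i => ((h i).outFrac j).1
  have hz0 : IsOrder l (fun i => 1 / (n i : ℂ)) 0 z :=
    Asymptotics.IsBigO.of_bound 1 (Filter.Eventually.of_forall fun i => by simpa using hz i)
  have hE : IsOrder l (fun i => 1 / (n i : ℂ)) 4 fun i =>
      z i - w * (midFrac w (z i) (n i) (n i - 1) - T i 0) := by
    refine Asymptotics.IsBigO.of_bound (‖c‖ * ‖c‖ ^ 4) (Filter.Eventually.of_forall fun i => ?_)
    have h1 := norm_pow_mul_midProd_le (hn i) (hw2 i) (hc i) (hz i)
    have h2 : (z i - w * (midFrac w (z i) (n i) (n i - 1) - T i 0)) ^ 2 =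
        (c ^ n i * midProd w (z i) (n i) (n i - 1)) ^ 2 := by
      rw [(h i).scalar_equation, ← hcw]
      ring
    have h3 : ‖z i - w * (midFrac w (z i) (n i) (n i - 1) - T i 0)‖ =
        ‖c ^ n i * midProd w (z i) (n i) (n i - 1)‖ := by
      rcases sq_eq_sq_iff_eq_or_eq_neg.1 h2 with h | h <;> rw [h]
      rw [norm_neg]
    rw [h3]
    refine h1.trans (le_of_eq ?_)
    rw [norm_pow, norm_div, norm_one, Complex.norm_natCast]
    ring
  have e₁ : ∀ i, midFrac w (z i) (n i) (n i - 1) *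
      (4 * ((n i : ℂ) - 1) + z i - w * midFrac w (z i) (n i) (n i - 2)) = 1 := fun i => by
    simpa using hr_eq 1 le_rfl (by norm_num) i
  have e₂ : ∀ i, midFrac w (z i) (n i) (n i - 2) *
      (8 * ((n i : ℂ) - 2) + z i - w * midFrac w (z i) (n i) (n i - 3)) = 1 := fun i => by
    have := hr_eq 2 (by norm_num) le_rfl i
    norm_num at this
    exact this
  have k₁ : ∀ i, T i 0 * (4 * ((n i : ℂ) + 1) - z i - w * T i 1) = 1 := fun i => by
    simpa using ht_eq 0 i
  have k₂ : ∀ i, T i 1 * (8 * ((n i : ℂ) + 2) - z i - w * T i 2) = 1 := fun i => by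
    have := ht_eq 1 i
    norm_num at this
    linear_combination this
  obtain ⟨hz2, hz4⟩ := isOrder_resonance hε hν hz0 (hr 1 le_rfl) (hr 2 (by norm_num))
    (hr 3 (by norm_num)) (ht 0) (ht 1) (ht 2) e₁ e₂ k₁ k₂ hE
  exact ⟨isOrder_midFrac_expansion hε hν hz2 (hr 1 le_rfl) (hr 2 (by norm_num)) e₁,
    isOrder_outFrac_expansion hε hν hz2 (ht 0) (ht 1) k₁,
    isOrder_normProd hl hn hw hz hz2 hz4⟩

end Family

theorem IsResonant.norm_outFrac_sub_le {w z z' : ℂ} {n : ℕ} {T T' : ℕ → ℂ} (hn : 2 ≤ n)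
    (hw : 2 * ‖w‖ ≤ n) (h : IsResonant w n z T) (h' : IsResonant w n z' T') (k : ℕ) :
    ‖T k - T' k‖ ≤ 2 * (‖z - z'‖ / (n : ℝ) ^ 2) := by
  refine norm_continuedFraction_sub_le (by exact_mod_cast hn) hw h.outFrac h'.outFrac
    (fun j => le_of_eq ?_) k
  rw [← norm_neg]
  simp only [outDiag]
  congr 1
  ring

/-- The slope between `z₁` and `z₂` of the right-hand side of the resonance equation. -/
noncomputable def fracSlope (w : ℂ) (n : ℕ) (z₁ z₂ : ℂ) (T₁ T₂ : ℕ → ℂ) : ℂ :=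
  w * ((midFrac w z₁ n (n - 1) - midFrac w z₂ n (n - 1)) - (T₁ 0 - T₂ 0)) / (z₁ - z₂)

/-- The square root of the ratio between the squared gap and its leading term. -/
noncomputable def gapRatio (w : ℂ) (n : ℕ) (z₁ z₂ : ℂ) (T₁ T₂ : ℕ → ℂ) : ℂ :=
  (normProd w z₁ n + normProd w z₂ n) / 2 * (1 - fracSlope w n z₁ z₂ T₁ T₂)⁻¹

theorem IsResonant.sq_sub_eq {w c z z' : ℂ} {n : ℕ} {T T' : ℕ → ℂ} (hn : 5 ≤ n)
    (hw : 8 * ‖w‖ ≤ n) (hc : ‖c‖ ≤ n) (hcw : c ^ 2 = w) (hne : z ≠ z')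
    (h : IsResonant w n z T) (h' : IsResonant w n z' T') :
    (z - z') ^ 2 = 64 * w ^ n / ((16 : ℂ) ^ n * ((n - 1).factorial : ℂ) ^ 4) *
      gapRatio w n z z' T T' ^ 2 := by
  have hw2 : 2 * ‖w‖ ≤ n := by linarith [norm_nonneg w]
  have hn2 : 2 ≤ n := by omega
  have hn5 : (5 : ℝ) ≤ n := by exact_mod_cast hn
  have hpos : 0 < ‖z - z'‖ := norm_pos_iff.2 (sub_ne_zero.2 hne)
  set r := midFrac w z n (n - 1)
  set r' := midFrac w z' n (n - 1)
  have hα : ‖w * (r - T 0) - w * (r' - T' 0)‖ ≤ ‖z - z'‖ / 4 := by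
    have h1 : ‖r - r'‖ ≤ 2 * (‖z - z'‖ / (n : ℝ) ^ 2) :=
      norm_midFrac_sub_le hn2 hw2 h.norm_le h'.norm_le (by omega)
    have h2 := h.norm_outFrac_sub_le hn2 hw2 h' 0
    have h3 : ‖(r - r') - (T 0 - T' 0)‖ ≤ 4 * (‖z - z'‖ / (n : ℝ) ^ 2) :=
      (norm_sub_le _ _).trans (by linarith)
    calc ‖w * (r - T 0) - w * (r' - T' 0)‖ = ‖w‖ * ‖(r - r') - (T 0 - T' 0)‖ := by
          rw [← norm_mul]; congr 1; ring
      _ ≤ ‖w‖ * (4 * (‖z - z'‖ / (n : ℝ) ^ 2)) := mul_le_mul_of_nonneg_left h3 (norm_nonneg _)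
      _ = (8 * ‖w‖) * (2 / (n : ℝ) ^ 2 * (‖z - z'‖ / 4)) := by ring
      _ ≤ n * (2 / (n : ℝ) ^ 2 * (‖z - z'‖ / 4)) := mul_le_mul_of_nonneg_right hw (by positivity)
      _ = 2 / n * (‖z - z'‖ / 4) := by field_simp
      _ ≤ 1 * (‖z - z'‖ / 4) := mul_le_mul_of_nonneg_right
          ((div_le_one (by linarith)).2 (by linarith)) (by positivity)
      _ = ‖z - z'‖ / 4 := one_mul _
  have sq_eq : ∀ {x : ℂ} {S : ℕ → ℂ}, IsResonant w n x S →
      (x - w * (midFrac w x n (n - 1) - S 0)) ^ 2 = (c ^ n * midProd w x n (n - 1)) ^ 2 := by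
    intro x S hx
    rw [hx.scalar_equation, ← hcw]
    ring
  have key := sq_sub_eq_of_contracting hne (sq_eq h) (sq_eq h') hα
    (norm_pow_mul_midProd_sub_le hn2 hcw hw hc h.norm_le h'.norm_le)
  have hzz : z - z' ≠ 0 := sub_ne_zero.2 hne
  have hslope : w * (r - T 0) - w * (r' - T' 0) = fracSlope w n z z' T T' * (z - z') := by
    rw [fracSlope, div_mul_cancel₀ _ hzz]
    ring
  have hA : 1 - fracSlope w n z z' T T' ≠ 0 := by
    intro h0
    rw [hslope, ← sub_eq_zero.1 h0, one_mul] at hα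
    linarith
  rw [hslope] at key
  have hf : ((n - 1).factorial : ℂ) ≠ 0 := by exact_mod_cast Nat.factorial_ne_zero _
  have h16 : (16 : ℂ) ^ n = 16 * (4 ^ (n - 1)) ^ 2 := by
    obtain ⟨m, rfl⟩ := Nat.exists_eq_add_of_le' (by omega : 1 ≤ n)
    rw [Nat.add_sub_cancel, ← pow_mul, mul_comm m 2, pow_mul, pow_succ]
    norm_num
    ring
  have h4 : (4 : ℂ) ^ (n - 1) ≠ 0 := pow_ne_zero _ (by norm_num)
  have hcn : c ^ n * c ^ n = w ^ n := by rw [← hcw]; ring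
  rw [gapRatio, normProd, normProd, h16, ← hcn]
  field_simp
  linear_combination 64 * key

section Family

variable {ι : Type*} {l : Filter ι} {n : ι → ℕ} {z z' : ι → ℂ} {T T' : ι → ℕ → ℂ} {w c : ℂ}

theorem isOrder_two_of_norm_le_mul {f : ι → ℂ} (hne : ∀ i, z i ≠ z' i)
    (hf : ∀ i, ‖f i‖ ≤ 2 * (‖z i - z' i‖ / (n i : ℝ) ^ 2)) :
    IsOrder l (fun i => 1 / (n i : ℂ)) 2 fun i => f i / (z i - z' i) := by
  refine Asymptotics.IsBigO.of_bound 2 (Filter.Eventually.of_forall fun i => ?_)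
  have hpos : 0 < ‖z i - z' i‖ := norm_pos_iff.2 (sub_ne_zero.2 (hne i))
  rw [norm_div, norm_pow, norm_div, norm_one, Complex.norm_natCast, div_le_iff₀ hpos]
  refine (hf i).trans (le_of_eq ?_)
  ring

theorem IsResonant.isOrder_gapRatio (hl : Filter.Tendsto n l Filter.atTop) (hn : ∀ i, 5 ≤ n i)
    (hw : ∀ i, 8 * ‖w‖ ≤ n i) (hc : ∀ i, ‖c‖ ≤ n i) (hcw : c ^ 2 = w) (hne : ∀ i, z i ≠ z' i)
    (h : ∀ i, IsResonant w (n i) (z i) (T i)) (h' : ∀ i, IsResonant w (n i) (z' i) (T' i)) :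
    IsOrder l (fun i => 1 / (n i : ℂ)) 4 fun i =>
      gapRatio w (n i) (z i) (z' i) (T i) (T' i) ^ 2 - (1 - w * (1 / (n i : ℂ)) ^ 3 / 2) := by
  have hε := tendsto_one_div_natCast hl
  have hw2 : ∀ i, 2 * ‖w‖ ≤ n i := fun i => by linarith [hw i, norm_nonneg w]
  have hn2 : ∀ i, 2 ≤ n i := fun i => by linarith [hn i]
  obtain ⟨er, et, eG⟩ := IsResonant.isOrder hl hn hw hc hcw h
  obtain ⟨er', et', eG'⟩ := IsResonant.isOrder hl hn hw hc hcw h'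
  have hr : ∀ {x : ι → ℂ} {S : ι → ℕ → ℂ}, (∀ i, IsResonant w (n i) (x i) (S i)) →
      IsOrder l (fun i => 1 / (n i : ℂ)) 1 fun i => midFrac w (x i) (n i) (n i - 1) := fun hx =>
    isOrder_one_of_norm_le fun i =>
      norm_midFrac_le (hn2 i) (hw2 i) (hx i).norm_le (by have := hn i; omega)
  have ht : ∀ {x : ι → ℂ} {S : ι → ℕ → ℂ}, (∀ i, IsResonant w (n i) (x i) (S i)) →
      IsOrder l (fun i => 1 / (n i : ℂ)) 1 fun i => S i 0 := fun hx =>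
    isOrder_one_of_norm_le fun i => ((hx i).outFrac 0).2
  have hq : IsOrder l (fun i => 1 / (n i : ℂ)) 2 fun i =>
      (midFrac w (z i) (n i) (n i - 2) - midFrac w (z' i) (n i) (n i - 2)) / (z i - z' i) :=
    isOrder_two_of_norm_le_mul hne fun i =>
      norm_midFrac_sub_le (hn2 i) (hw2 i) (h i).norm_le (h' i).norm_le (by have := hn i; omega)
  have hs : IsOrder l (fun i => 1 / (n i : ℂ)) 2 fun i => (T i 1 - T' i 1) / (z i - z' i) :=
    isOrder_two_of_norm_le_mul hne fun i => (h i).norm_outFrac_sub_le (hn2 i) (hw2 i) (h' i) 1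
  refine isOrder_sq_expansion hε (isOrder_slope hε (hr h) (hr h') (ht h) (ht h') hq hs er er' et
    et' fun i => ?_) eG eG' fun i => rfl
  have h5 := hn i
  have hzz : z i - z' i ≠ 0 := sub_ne_zero.2 (hne i)
  have e : n i - 2 + 1 = n i - 1 := by omega
  have m1 := (midFrac_spec (hn2 i) (hw2 i) (h i).norm_le (by omega : n i - 2 + 1 < n i)).1
  have m2 := (midFrac_spec (hn2 i) (hw2 i) (h' i).norm_le (by omega : n i - 2 + 1 < n i)).1
  have d1 := sub_of_continuedFraction m1 m2
  have d2 := sub_of_continuedFraction ((h i).outFrac 0).1 ((h' i).outFrac 0).1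
  rw [e] at d1
  simp only [midDiag, outDiag, zero_add] at d1 d2
  rw [fracSlope, d1, d2]
  field_simp
  ring

end Family

theorem IsMathieuEig.exists_isResonant {a b lam : ℂ} {n : ℕ} (hn : 2 ≤ n) (ha : 2 * ‖a‖ ≤ n)
    (hb : 2 * ‖b‖ ≤ n) (hw : 2 * ‖a * b‖ ≤ n)
    (h : IsMathieuEig a b (if Even n then 1 else -1) lam) (hlam : ‖lam - (n : ℂ) ^ 2‖ ≤ 1) :
    ∃ T, IsResonant (a * b) n (lam - (n : ℂ) ^ 2) T := by
  obtain ⟨T, hT⟩ := exists_continuedFraction (e := outDiag n (lam - (n : ℂ) ^ 2)) (w := a * b)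
    (N := n) (by exact_mod_cast hn) hw (le_norm_outDiag hn hlam)
  exact ⟨T, hlam, hT, IsMathieuEig.scalar_equation hn ha hb hw hlam hT (by simpa using h)⟩

theorem harrell_avron_simon_extension (a b : ℂ) :
    ∃ N : ℕ, ∃ C : ℝ, 0 < C ∧ ∀ n : ℕ, N < n →
      ∀ μ ν : ℂ, μ ≠ ν →
        IsMathieuEig a b (if Even n then 1 else -1) μ →
        IsMathieuEig a b (if Even n then 1 else -1) ν →
        ‖μ - (n : ℂ)^2‖ ≤ 1 → ‖ν - (n : ℂ)^2‖ ≤ 1 →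
        ∃ r : ℂ, ‖r‖ ≤ C / (n : ℝ)^4 ∧
          (μ - ν)^2 = 64 * (a * b)^n / ((16 : ℂ)^n * ((Nat.factorial (n - 1) : ℂ))^4) *
            (1 - a * b / (2 * (n : ℂ)^3) + r) := by
  obtain ⟨c, hc⟩ := IsAlgClosed.exists_pow_nat_eq (a * b) (n := 2) two_pos
  obtain ⟨M, hM⟩ := exists_nat_ge (5 + 2 * ‖a‖ + 2 * ‖b‖ + 8 * ‖a * b‖ + ‖c‖)
  let ι := {p : ℕ × (ℂ × (ℕ → ℂ)) × (ℂ × (ℕ → ℂ)) // M ≤ p.1 ∧ p.2.1.1 ≠ p.2.2.1 ∧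
    IsResonant (a * b) p.1 p.2.1.1 p.2.1.2 ∧ IsResonant (a * b) p.1 p.2.2.1 p.2.2.2}
  have hMle : ∀ n : ℕ, M ≤ n →
      5 + 2 * ‖a‖ + 2 * ‖b‖ + 8 * ‖a * b‖ + ‖c‖ ≤ n := fun n hn =>
    hM.trans (by exact_mod_cast hn)
  have h5 : ∀ n : ℕ, M ≤ n → 5 ≤ n := fun n hn => by
    have : (5 : ℝ) ≤ n := by
      linarith [hMle n hn, norm_nonneg a, norm_nonneg b, norm_nonneg (a * b), norm_nonneg c]
    exact_mod_cast this
  have h8 : ∀ n : ℕ, M ≤ n → 8 * ‖a * b‖ ≤ n := fun n hn => by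
    linarith [hMle n hn, norm_nonneg a, norm_nonneg b, norm_nonneg (a * b), norm_nonneg c]
  have hcn : ∀ n : ℕ, M ≤ n → ‖c‖ ≤ n := fun n hn => by
    linarith [hMle n hn, norm_nonneg a, norm_nonneg b, norm_nonneg (a * b), norm_nonneg c]
  obtain ⟨C, hC⟩ := Asymptotics.IsBigO.bound
    (IsResonant.isOrder_gapRatio (ι := ι) (l := Filter.comap (fun i : ι => i.1.1) Filter.atTop)
      (n := fun i => i.1.1) (z := fun i => i.1.2.1.1) (z' := fun i => i.1.2.2.1)
      (T := fun i => i.1.2.1.2) (T' := fun i => i.1.2.2.2) Filter.tendsto_comap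
      (fun i => h5 _ i.2.1) (fun i => h8 _ i.2.1) (fun i => hcn _ i.2.1) hc
      (fun i => i.2.2.1) (fun i => i.2.2.2.1) (fun i => i.2.2.2.2))
  obtain ⟨N, hN⟩ := Filter.eventually_atTop.1 (Filter.eventually_comap.1 hC)
  refine ⟨max M N, max C 1, by positivity, fun n hn μ ν hne hμ hν hμn hνn => ?_⟩
  have hMn : M ≤ n := (le_max_left M N).trans hn.le
  have hn2 : 2 ≤ n := by linarith [h5 n hMn]
  have ha : 2 * ‖a‖ ≤ n := by
    linarith [hMle n hMn, norm_nonneg a, norm_nonneg b, norm_nonneg (a * b), norm_nonneg c]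
  have hb : 2 * ‖b‖ ≤ n := by
    linarith [hMle n hMn, norm_nonneg a, norm_nonneg b, norm_nonneg (a * b), norm_nonneg c]
  have hw : 2 * ‖a * b‖ ≤ n := by linarith [h8 n hMn, norm_nonneg (a * b)]
  obtain ⟨T, hT⟩ := hμ.exists_isResonant hn2 ha hb hw hμn
  obtain ⟨T', hT'⟩ := hν.exists_isResonant hn2 ha hb hw hνn
  have hzz : μ - (n : ℂ) ^ 2 ≠ ν - (n : ℂ) ^ 2 := fun h => hne (sub_left_inj.1 h)
  have hbound := hN n ((le_max_right M N).trans hn.le)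
    ⟨(n, (μ - (n : ℂ) ^ 2, T), (ν - (n : ℂ) ^ 2, T')), hMn, hzz, hT, hT'⟩ rfl
  refine ⟨_, hbound.trans ?_, ?_⟩
  · rw [norm_pow, norm_div, norm_one, Complex.norm_natCast, one_div, inv_pow, ← div_eq_mul_inv]
    gcongr
    exact le_max_left _ _
  · have h := IsResonant.sq_sub_eq (h5 n hMn) (h8 n hMn) (hcn n hMn) hc hzz hT hT'
    have e : a * b * (1 / (n : ℂ)) ^ 3 / 2 = a * b / (2 * (n : ℂ) ^ 3) := by
      rw [one_div, inv_pow]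
      ring
    rw [sub_sub_sub_cancel_right] at h
    rw [h, e]
    ring
end

section
/- Let q : ℝ → ℂ be 1-periodic and integrable on [0,1] with Fourier coefficients q_m = 0 for all integers m ≤ 0, and let t ∈ (−π, π]. Then a complex number λ is an eigenvalue of L_t(q) if and only if λ = (2πn + t)² for some integer n. -/
open Real Complex Set MeasureTheory

/-- The `m`-th Fourier coefficient of `q` on `[0,1]`. -/
noncomputable def fourierCoeff01 (q : ℝ → ℂ) (m : ℤ) : ℂ :=
  ∫ x in (0:ℝ)..1, q x * Complex.exp (-(2 * Real.pi * Complex.I * m) * (x : ℂ))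

/-- `y` is an eigenfunction of `L_t(q)` corresponding to `λ`, in the integrated
(Carathéodory) sense: `y` is continuously differentiable with derivative `g`
satisfying `g x = g 0 + ∫₀ˣ (q − λ) y`, `y` is not identically zero on `[0,1]`,
and `y` satisfies the `t`-quasiperiodic boundary conditions. -/
def IsEigenfunL (q : ℝ → ℂ) (t : ℝ) (lam : ℂ) (y : ℝ → ℂ) : Prop :=
  ∃ g : ℝ → ℂ, ContinuousOn y (Set.Icc (0:ℝ) 1) ∧ ContinuousOn g (Set.Icc (0:ℝ) 1) ∧
    (∀ x ∈ Set.Icc (0:ℝ) 1, y x = y 0 + ∫ s in (0:ℝ)..x, g s) ∧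
    (∀ x ∈ Set.Icc (0:ℝ) 1, g x = g 0 + ∫ s in (0:ℝ)..x, (q s - lam) * y s) ∧
    (¬ ∀ x ∈ Set.Icc (0:ℝ) 1, y x = 0) ∧
    y 1 = Complex.exp (Complex.I * t) * y 0 ∧
    g 1 = Complex.exp (Complex.I * t) * g 0

/-- `λ` is an eigenvalue of `L_t(q)`. -/
def IsEigenvalueL (q : ℝ → ℂ) (t : ℝ) (lam : ℂ) : Prop :=
  ∃ y : ℝ → ℂ, IsEigenfunL q t lam y

/-- The trigonometric frequency `2πn + t`. -/
noncomputable def qFreq (t : ℝ) (n : ℤ) : ℝ := 2 * Real.pi * n + t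

/-- The quasiperiodic exponential `x ↦ exp(i(2πn + t)x)`. -/
noncomputable def qExp (t : ℝ) (n : ℤ) (x : ℝ) : ℂ := Complex.exp (Complex.I * qFreq t n * x)

/-- The coefficient of `f` with respect to `qExp t n` on `[0,1]`. -/
noncomputable def qCoeff (t : ℝ) (f : ℝ → ℂ) (n : ℤ) : ℂ :=
  ∫ x in (0:ℝ)..1, f x * Complex.exp (-(Complex.I * qFreq t n) * x)

theorem norm_exp_neg_I_mul (w x : ℝ) : ‖Complex.exp (-(Complex.I * w) * x)‖ = 1 := by
  rw [show -(Complex.I * w) * x = ((-(w * x) : ℝ) : ℂ) * Complex.I by push_cast; ring]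
  exact Complex.norm_exp_ofReal_mul_I _

theorem norm_qExp (t : ℝ) (n : ℤ) (x : ℝ) : ‖qExp t n x‖ = 1 := by
  rw [qExp, show Complex.I * qFreq t n * x = ((qFreq t n * x : ℝ) : ℂ) * Complex.I by
    push_cast; ring]
  exact Complex.norm_exp_ofReal_mul_I _

theorem continuous_qExp (t : ℝ) (n : ℤ) : Continuous (qExp t n) := by
  unfold qExp; fun_prop

theorem qExp_zero (t : ℝ) (n : ℤ) : qExp t n 0 = 1 := by simp [qExp]

theorem qExp_one (t : ℝ) (n : ℤ) : qExp t n 1 = Complex.exp (Complex.I * t) := by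
  rw [qExp, Complex.exp_eq_exp_iff_exists_int]
  exact ⟨n, by simp only [qFreq]; push_cast; ring⟩

theorem qExp_mul_exp_neg (t : ℝ) (k n : ℤ) (x : ℝ) :
    qExp t k x * Complex.exp (-(Complex.I * qFreq t n) * x) =
      Complex.exp (-(2 * Real.pi * Complex.I * (n - k : ℤ)) * x) := by
  rw [qExp, ← Complex.exp_add]
  congr 1
  simp only [qFreq]; push_cast; ring

theorem exp_neg_qFreq (t : ℝ) (n : ℤ) :
    Complex.exp (-(Complex.I * qFreq t n)) * Complex.exp (Complex.I * t) = 1 := by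
  rw [← qExp_one t n, qExp, ← Complex.exp_add]
  simp

theorem continuous_exp_neg_qFreq (t : ℝ) (n : ℤ) :
    Continuous fun x : ℝ => Complex.exp (-(Complex.I * qFreq t n) * x) := by
  fun_prop

/-- Integration by parts for a primitive of an integrable function against a `C¹` function. -/
theorem integral_primitive_mul_deriv {f φ φ' : ℝ → ℂ}
    (hf : IntervalIntegrable f volume 0 1) (hφ : ∀ x, HasDerivAt φ (φ' x) x)
    (hφ' : Continuous φ') :
    ∫ x in (0:ℝ)..1, (∫ s in (0:ℝ)..x, f s) * φ' x =
      ∫ s in (0:ℝ)..1, f s * (φ 1 - φ s) := by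
  have h01 : (0:ℝ) ≤ 1 := zero_le_one
  set μ : Measure ℝ := volume.restrict (Set.Ioc 0 1) with hμ
  have hf' : Integrable f μ := (intervalIntegrable_iff_integrableOn_Ioc_of_le h01).1 hf
  have hφi : Integrable φ' μ :=
    (intervalIntegrable_iff_integrableOn_Ioc_of_le h01).1 (hφ'.intervalIntegrable 0 1)
  have hT : MeasurableSet {p : ℝ × ℝ | p.2 ≤ p.1} := measurableSet_le measurable_snd measurable_fst
  have hK : Integrable ({p : ℝ × ℝ | p.2 ≤ p.1}.indicator fun p => φ' p.1 * f p.2) (μ.prod μ) :=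
    (hφi.mul_prod hf').indicator hT
  have hswap := integral_integral_swap
    (f := fun x s => {p : ℝ × ℝ | p.2 ≤ p.1}.indicator (fun p => φ' p.1 * f p.2) (x, s)) hK
  rw [intervalIntegral.integral_of_le h01, intervalIntegral.integral_of_le h01]
  convert hswap using 1
  · refine setIntegral_congr_fun measurableSet_Ioc fun x hx => ?_
    have : (fun s => {p : ℝ × ℝ | p.2 ≤ p.1}.indicator (fun p => φ' p.1 * f p.2) (x, s)) =
        (Set.Iic x).indicator fun s => φ' x * f s := by
      ext s; simp [Set.indicator_apply]
    rw [this, hμ, setIntegral_indicator measurableSet_Iic, integral_const_mul,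
      intervalIntegral.integral_of_le hx.1.le, mul_comm]
    congr 3
    ext s; simp only [Set.mem_Ioc, Set.mem_inter_iff, Set.mem_Iic]
    exact ⟨fun h => ⟨⟨h.1, h.2.trans hx.2⟩, h.2⟩, fun h => ⟨h.1.1, h.2⟩⟩
  · refine setIntegral_congr_fun measurableSet_Ioc fun s hs => ?_
    have : (fun x => {p : ℝ × ℝ | p.2 ≤ p.1}.indicator (fun p => φ' p.1 * f p.2) (x, s)) =
        (Set.Ici s).indicator fun x => φ' x * f s := by
      ext x; simp [Set.indicator_apply]
    rw [this, hμ, setIntegral_indicator measurableSet_Ici, integral_mul_const, mul_comm,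
      ← intervalIntegral.integral_eq_sub_of_hasDerivAt (fun x _ => hφ x)
        (hφ'.intervalIntegrable s 1), intervalIntegral.integral_of_le hs.2,
      ← integral_Icc_eq_integral_Ioc]
    congr 3
    ext x; simp only [Set.mem_Icc, Set.mem_inter_iff, Set.mem_Ici, Set.mem_Ioc]
    exact ⟨fun h => ⟨⟨hs.1.trans_le h.1, h.2⟩, h.1⟩, fun h => ⟨h.2, h.1.2⟩⟩

theorem integral_qExp_coeff_eq (t : ℝ) (n : ℤ) :
    Complex.I * qFreq t n * ∫ x in (0:ℝ)..1, Complex.exp (-(Complex.I * qFreq t n) * x) =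
      1 - Complex.exp (-(Complex.I * qFreq t n)) := by
  have hd : ∀ x : ℝ, HasDerivAt (fun x : ℝ => Complex.exp (-(Complex.I * qFreq t n) * x))
      (-(Complex.I * qFreq t n) * Complex.exp (-(Complex.I * qFreq t n) * x)) x := by
    intro x
    have := ((hasDerivAt_id (x : ℂ)).const_mul (-(Complex.I * qFreq t n))).cexp.comp_ofReal
    simpa [mul_comm] using this
  have := intervalIntegral.integral_eq_sub_of_hasDerivAt (a := 0) (b := 1) (fun x _ => hd x)
    (Continuous.intervalIntegrable (by fun_prop) _ _)
  rw [intervalIntegral.integral_const_mul] at this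
  simp only [Complex.ofReal_one, Complex.ofReal_zero, mul_one, mul_zero, Complex.exp_zero] at this
  linear_combination -this

/-- Coefficients of the derivative of a quasiperiodic function. -/
theorem qCoeff_eq_of_primitive {t : ℝ} {f G : ℝ → ℂ} (hf : IntervalIntegrable f volume 0 1)
    (hG : ∀ x ∈ Set.Icc (0:ℝ) 1, G x = G 0 + ∫ s in (0:ℝ)..x, f s)
    (hb : G 1 = Complex.exp (Complex.I * t) * G 0) (n : ℤ) :
    qCoeff t f n = Complex.I * qFreq t n * qCoeff t G n := by
  set w : ℂ := Complex.I * qFreq t n with hw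
  have hd : ∀ x : ℝ, HasDerivAt (fun x : ℝ => Complex.exp (-w * x))
      (-w * Complex.exp (-w * x)) x := by
    intro x
    have := ((hasDerivAt_id (x : ℂ)).const_mul (-w)).cexp.comp_ofReal
    simpa [mul_comm] using this
  have hc : Continuous fun x : ℝ => Complex.exp (-w * x) := by fun_prop
  have key := integral_primitive_mul_deriv hf hd (by fun_prop)
  have hP : ContinuousOn (fun x => ∫ s in (0:ℝ)..x, f s) (Set.uIcc 0 1) :=
    intervalIntegral.continuousOn_primitive_interval' hf (by simp)
  have h1 : qCoeff t G n = G 0 * (∫ x in (0:ℝ)..1, Complex.exp (-w * x)) +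
      ∫ x in (0:ℝ)..1, (∫ s in (0:ℝ)..x, f s) * Complex.exp (-w * x) := by
    rw [← intervalIntegral.integral_const_mul, ← intervalIntegral.integral_add
      (Continuous.intervalIntegrable (by fun_prop) _ _)
      (show ContinuousOn (fun x : ℝ => (∫ s in (0:ℝ)..x, f s) * Complex.exp (-w * x)) _ from
        hP.mul hc.continuousOn).intervalIntegrable, qCoeff]
    refine intervalIntegral.integral_congr fun x hx => ?_
    rw [Set.uIcc_of_le zero_le_one] at hx
    rw [hG x hx]; ring
  have h2 : ∫ x in (0:ℝ)..1, (∫ s in (0:ℝ)..x, f s) * (-w * Complex.exp (-w * x)) =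
      -w * ∫ x in (0:ℝ)..1, (∫ s in (0:ℝ)..x, f s) * Complex.exp (-w * x) := by
    rw [← intervalIntegral.integral_const_mul]
    congr 1; ext x; ring
  have h3 : ∫ s in (0:ℝ)..1, f s * (Complex.exp (-w * (1:ℝ)) - Complex.exp (-w * s)) =
      (∫ s in (0:ℝ)..1, f s) * Complex.exp (-w) - qCoeff t f n := by
    rw [← intervalIntegral.integral_mul_const, qCoeff, ← intervalIntegral.integral_sub
      (hf.mul_const _) (hf.mul_continuousOn hc.continuousOn)]
    refine intervalIntegral.integral_congr fun x hx => ?_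
    simp only [Complex.ofReal_one, mul_one]
    ring
  have h4 := hG 1 (by simp)
  have h5 := integral_qExp_coeff_eq t n
  have h6 := exp_neg_qFreq t n
  rw [← hw] at h5 h6
  rw [h2, h3] at key
  rw [h1]
  linear_combination key - G 0 * h5 - Complex.exp (-w) * h4 + Complex.exp (-w) * hb + G 0 * h6

/-- A quasiperiodic continuous function with summable coefficients is the sum of its series. -/
theorem hasSum_qCoeff {t : ℝ} {y : ℝ → ℂ} (hy : ContinuousOn y (Set.Icc 0 1))
    (hb : y 1 = Complex.exp (Complex.I * t) * y 0) (hs : Summable (qCoeff t y)) :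
    ∀ x ∈ Set.Icc (0:ℝ) 1, HasSum (fun n => qCoeff t y n * qExp t n x) (y x) := by
  have : Fact ((0:ℝ) < 1) := ⟨zero_lt_one⟩
  set z : ℝ → ℂ := fun x => y x * Complex.exp (-(Complex.I * t) * x) with hz
  have hzc : ContinuousOn z (Set.Icc 0 1) := hy.mul (by fun_prop)
  have hz01 : z 0 = z 1 := by
    simp only [hz, hb, Complex.ofReal_zero, Complex.ofReal_one, mul_zero, mul_one, Complex.exp_zero]
    rw [mul_comm, ← mul_assoc, ← Complex.exp_add]; simp
  let F : C(AddCircle (1:ℝ), ℂ) :=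
    ⟨AddCircle.liftIco 1 0 z, AddCircle.liftIco_zero_continuous hz01 hzc⟩
  have hF : ∀ n, fourierCoeff F n = qCoeff t y n := by
    intro n
    change fourierCoeff (AddCircle.liftIco 1 0 z) n = _
    rw [fourierCoeff_liftIco_eq, fourierCoeffOn_eq_integral]
    simp only [zero_add, sub_zero, ne_eq, one_ne_zero, not_false_eq_true, div_self, one_smul, qCoeff]
    refine intervalIntegral.integral_congr fun x _ => ?_
    simp only [smul_eq_mul, hz]
    rw [fourier_coe_apply, mul_left_comm, ← Complex.exp_add]
    congr 2
    simp only [qFreq]; push_cast; ring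
  have hFs : Summable (fourierCoeff F) := by rwa [show fourierCoeff F = qCoeff t y from funext hF]
  have hmain : ∀ x ∈ Set.Ico (0:ℝ) 1, HasSum (fun n => qCoeff t y n * qExp t n x) (y x) := by
    intro x hx
    have h := (has_pointwise_sum_fourier_series_of_summable hFs (x : AddCircle (1:ℝ))).mul_right
      (Complex.exp (Complex.I * t * x))
    have hFx : F (x : AddCircle (1:ℝ)) = z x :=
      AddCircle.liftIco_coe_apply (f := z) (show x ∈ Set.Ico (0:ℝ) (0 + 1) by simpa using hx)
    have hyx : F (x : AddCircle (1:ℝ)) * Complex.exp (Complex.I * t * x) = y x := by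
      rw [hFx, hz]
      simp only
      rw [mul_assoc, ← Complex.exp_add]; simp
    have he : (fun n => qCoeff t y n * qExp t n x) = fun n =>
        fourierCoeff F n • fourier n (x : AddCircle (1:ℝ)) * Complex.exp (Complex.I * t * x) := by
      ext n
      rw [hF, fourier_coe_apply, smul_eq_mul, mul_assoc, ← Complex.exp_add, qExp]
      congr 2
      simp only [qFreq]; push_cast; ring
    rwa [he, ← hyx]
  intro x hx
  rcases eq_or_lt_of_le hx.2 with rfl | h
  · have h0 := (hmain 0 (by simp)).mul_left (Complex.exp (Complex.I * t))
    rw [hb]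
    have he : (fun n => qCoeff t y n * qExp t n 1) =
        fun n => Complex.exp (Complex.I * t) * (qCoeff t y n * qExp t n 0) := by
      ext n; rw [qExp_one, qExp_zero]; ring
    rwa [he]
  · exact hmain x ⟨hx.1, h⟩

/-- Coefficients of the product of an integrable function with an absolutely convergent series. -/
theorem hasSum_qCoeff_mul {ι : Type*} [Countable ι] {t : ℝ} {q y : ℝ → ℂ}
    (hq : IntervalIntegrable q volume 0 1) {c : ι → ℂ} (hc : Summable c) (k : ι → ℤ)
    (hy : ∀ x ∈ Set.Icc (0:ℝ) 1, HasSum (fun i => c i * qExp t (k i) x) (y x)) (n : ℤ) :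
    HasSum (fun i => c i * fourierCoeff01 q (n - k i)) (qCoeff t (fun x => q x * y x) n) := by
  have h01 : (0:ℝ) ≤ 1 := zero_le_one
  let F : ι → ℝ → ℂ := fun i x =>
    c i * (q x * Complex.exp (-(2 * Real.pi * Complex.I * (n - k i : ℤ)) * x))
  have hnorm : ∀ i x, ‖F i x‖ = ‖c i‖ * ‖q x‖ := by
    intro i x
    simp only [F, norm_mul]
    rw [← qExp_mul_exp_neg t, norm_mul, norm_qExp, norm_exp_neg_I_mul]; simp
  have hFi : ∀ i, Integrable (F i) (volume.restrict (Set.Ioc 0 1)) := by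
    intro i
    have : Continuous fun x : ℝ => Complex.exp (-(2 * Real.pi * Complex.I * (n - k i : ℤ)) * x) := by
      fun_prop
    exact ((intervalIntegrable_iff_integrableOn_Ioc_of_le h01).1
      (hq.mul_continuousOn this.continuousOn)).const_mul _
  have hsum : Summable fun i => ∫ x in Set.Ioc (0:ℝ) 1, ‖F i x‖ := by
    simp only [hnorm, integral_const_mul]
    exact hc.norm.mul_right _
  have h := hasSum_integral_of_summable_integral_norm hFi hsum
  have hval : qCoeff t (fun x => q x * y x) n = ∫ x in Set.Ioc (0:ℝ) 1, ∑' i, F i x := by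
    rw [qCoeff, intervalIntegral.integral_of_le h01]
    refine setIntegral_congr_fun measurableSet_Ioc fun x hx => ?_
    have hx' := ((hy x ⟨hx.1.le, hx.2⟩).mul_left (q x)).mul_right
      (Complex.exp (-(Complex.I * qFreq t n) * x))
    rw [← hx'.tsum_eq]
    refine tsum_congr fun i => ?_
    simp only [F]
    rw [← qExp_mul_exp_neg t]; ring
  rw [hval]
  have hterm : (fun i => c i * fourierCoeff01 q (n - k i)) =
      fun i => ∫ x in Set.Ioc (0:ℝ) 1, F i x := by
    ext i
    rw [fourierCoeff01, intervalIntegral.integral_of_le h01, integral_const_mul]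
  rwa [hterm]

theorem summable_inv_norm_sub_qFreq_sq (t : ℝ) (lam : ℂ) :
    Summable fun n : ℤ => ‖lam - (qFreq t n : ℂ) ^ 2‖⁻¹ := by
  have hpi := Real.pi_pos
  have h1 := (Real.summable_one_div_int_add_rpow (t / (2 * Real.pi)) 2).2 (by norm_num)
  have hfin : ∀ᶠ n : ℤ in Filter.cofinite, 2 * ‖lam‖ + 1 + |t| ≤ |(n:ℝ)| := by
    have := (tendsto_norm_cocompact_atTop (E := ℝ)).comp Int.tendsto_coe_cofinite
    exact this.eventually_ge_atTop _
  refine Summable.of_norm_bounded_eventually h1 ?_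
  filter_upwards [hfin] with n hn
  rw [norm_inv, norm_norm]
  set s := (n : ℝ) + t / (2 * Real.pi) with hs
  have hω : qFreq t n = 2 * Real.pi * s := by rw [qFreq, hs]; field_simp
  have ht' : |t / (2 * Real.pi)| ≤ |t| := by
    rw [abs_div, abs_of_pos (show 0 < 2 * Real.pi by positivity)]
    exact div_le_self (abs_nonneg _) (by linarith [Real.pi_gt_three])
  have hs1 : 2 * ‖lam‖ + 1 ≤ |s| := by
    have := abs_sub_abs_le_abs_sub (n:ℝ) (-(t / (2 * Real.pi)))
    rw [abs_neg, sub_neg_eq_add, ← hs] at this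
    linarith
  have hl := norm_nonneg lam
  have hs2 : 0 < |s| ^ 2 := pow_pos (by linarith) 2
  have hs3 : 2 * ‖lam‖ + 1 ≤ |s| ^ 2 := by nlinarith
  have hb : |s| ^ 2 ≤ ‖lam - (qFreq t n : ℂ) ^ 2‖ := by
    have h2 : ‖(qFreq t n : ℂ) ^ 2‖ = (2 * Real.pi) ^ 2 * |s| ^ 2 := by
      rw [norm_pow, Complex.norm_real, Real.norm_eq_abs, hω, abs_mul,
        abs_of_pos (show 0 < 2 * Real.pi by positivity), mul_pow]
    have h3 := norm_sub_norm_le ((qFreq t n : ℂ) ^ 2) lam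
    rw [norm_sub_rev, h2] at h3
    have h4 : 9 ≤ (2 * Real.pi) ^ 2 := by nlinarith [Real.pi_gt_three]
    nlinarith
  rw [one_div, Real.rpow_two]
  exact inv_anti₀ hs2 hb

/-- A discrete Gronwall inequality on `ℤ`, started from `-∞`. -/
theorem eq_zero_of_le_mul_tsum_Iio {u b : ℤ → ℝ} (hu : Summable u) (hu0 : ∀ n, 0 ≤ u n)
    (hb : Summable b) (hb0 : ∀ n, 0 ≤ b n)
    (h : ∀ n, u n ≤ b n * ∑' k, (Set.Iio n).indicator u k) : ∀ n, u n = 0 := by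
  have hsplit : ∃ N : ℤ, ∑' n, (Set.Iio N).indicator b n < 1 := by
    obtain ⟨s, hs⟩ := ((tendsto_order.1 (tendsto_tsum_compl_atTop_zero b)).2 1 one_pos).exists
    obtain ⟨N, hN⟩ : ∃ N : ℤ, ∀ n ∈ s, N ≤ n := s.bddBelow
    refine ⟨N, lt_of_le_of_lt ?_ hs⟩
    rw [show ∑' a : {x // x ∉ s}, b a = ∑' n, ({x | x ∉ s} : Set ℤ).indicator b n from
      tsum_subtype {x | x ∉ s} b]
    refine Summable.tsum_le_tsum (fun k => ?_) (hb.indicator _) (hb.indicator _)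
    refine Set.indicator_le_indicator_of_subset (fun n hn hns => ?_) hb0 k
    exact absurd (hN n hns) (not_le.2 hn)
  obtain ⟨N, hN⟩ := hsplit
  set S := ∑' k, (Set.Iio N).indicator u k with hS
  have hS0 : 0 ≤ S := tsum_nonneg fun k => Set.indicator_nonneg (fun k _ => hu0 k) k
  have hle : ∀ n, (Set.Iio N).indicator u n ≤ (Set.Iio N).indicator b n * S := by
    intro n
    by_cases hn : n ∈ Set.Iio N
    · rw [Set.indicator_of_mem hn, Set.indicator_of_mem hn]
      refine (h n).trans (mul_le_mul_of_nonneg_left ?_ (hb0 n))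
      refine Summable.tsum_le_tsum (fun k => ?_) (hu.indicator _) (hu.indicator _)
      exact Set.indicator_le_indicator_of_subset (Set.Iio_subset_Iio (le_of_lt hn)) hu0 k
    · simp [Set.indicator_of_notMem hn]
  have hSle : S ≤ (∑' n, (Set.Iio N).indicator b n) * S := by
    rw [← tsum_mul_right]
    exact Summable.tsum_le_tsum hle (hu.indicator _) ((hb.indicator _).mul_right _)
  have hSz : S = 0 := by nlinarith
  have hlow : ∀ n, n < N → u n = 0 := by
    intro n hn
    have := hle n
    rw [hSz, mul_zero, Set.indicator_of_mem (show n ∈ Set.Iio N from hn)] at this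
    exact le_antisymm this (hu0 n)
  have hup : ∀ m : ℕ, ∀ n : ℤ, n < N + m → u n = 0 := by
    intro m
    induction m with
    | zero => intro n hn; exact hlow n (by simpa using hn)
    | succ m ih =>
      intro n hn
      refine le_antisymm ((h n).trans_eq ?_) (hu0 n)
      have : (Set.Iio n).indicator u = 0 := by
        ext k
        by_cases hk : k ∈ Set.Iio n
        · rw [Set.indicator_of_mem hk]
          exact ih k (by simp only [Set.mem_Iio] at hk; push_cast at hn; omega)
        · rw [Set.indicator_of_notMem hk]; rfl
      simp [this]
  intro n
  exact hup (n - N + 1).toNat n (by omega)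

/-- The solution of `c j = a j * ∑_{i<j} p (j - i) * c i` normalized by `c 0 = 1`. -/
noncomputable def convRec (a p : ℕ → ℂ) : ℕ → ℂ
  | 0 => 1
  | j + 1 => a (j + 1) * ∑ i : Fin (j + 1), p (j + 1 - i) * convRec a p i

theorem convRec_succ (a p : ℕ → ℂ) (j : ℕ) :
    convRec a p (j + 1) =
      a (j + 1) * ∑ i ∈ Finset.range (j + 1), p (j + 1 - i) * convRec a p i := by
  rw [convRec, Finset.sum_range]

theorem summable_convRec {a p : ℕ → ℂ} {Q : ℝ} (hp : ∀ m, ‖p m‖ ≤ Q)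
    (ha : Summable fun j => ‖a j‖) : Summable (convRec a p) := by
  have hQ : 0 ≤ Q := (norm_nonneg _).trans (hp 0)
  set b : ℕ → ℝ := fun j => Q * ‖a (j + 1)‖ with hb
  have hb0 : ∀ j, 0 ≤ b j := fun j => by positivity
  have hbs : Summable b := ((summable_nat_add_iff 1).2 ha).mul_left Q
  have hle : ∀ j, ‖convRec a p (j + 1)‖ ≤
      b j * ∑ i ∈ Finset.range (j + 1), ‖convRec a p i‖ := by
    intro j
    rw [convRec_succ, norm_mul, hb]
    simp only
    rw [mul_comm Q, mul_assoc, Finset.mul_sum]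
    refine mul_le_mul_of_nonneg_left ((norm_sum_le _ _).trans ?_) (norm_nonneg _)
    refine Finset.sum_le_sum fun i _ => ?_
    rw [norm_mul]
    exact mul_le_mul_of_nonneg_right (hp _) (norm_nonneg _)
  have hexp : ∀ n, ∑ i ∈ Finset.range (n + 1), ‖convRec a p i‖ ≤
      Real.exp (∑ j ∈ Finset.range n, b j) := by
    intro n
    induction n with
    | zero => simp [convRec]
    | succ n ih =>
      rw [Finset.sum_range_succ _ (n + 1), Finset.sum_range_succ b n, Real.exp_add]
      set s := ∑ i ∈ Finset.range (n + 1), ‖convRec a p i‖ with hs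
      have hs0 : 0 ≤ s := Finset.sum_nonneg fun _ _ => norm_nonneg _
      have := hle n
      have h1 := Real.add_one_le_exp (b n)
      calc s + ‖convRec a p (n + 1)‖ ≤ s * (b n + 1) := by linarith
        _ ≤ _ := mul_le_mul ih h1 (by linarith [hb0 n]) (Real.exp_pos _).le
  refine Summable.of_norm (summable_of_sum_range_le (c := Real.exp (∑' j, b j))
    (fun _ => norm_nonneg _) fun n => ?_)
  refine (Finset.sum_le_sum_of_subset_of_nonneg (Finset.range_mono (Nat.le_succ n))
    fun _ _ _ => norm_nonneg _).trans ((hexp n).trans ?_)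
  exact Real.exp_le_exp.2 (hbs.sum_le_tsum _ fun i _ => hb0 i)

theorem eq_zero_of_exp_I_mul_eq_one {t : ℝ} (ht : t ∈ Set.Ioc (-Real.pi) Real.pi)
    (h : Complex.exp (Complex.I * t) = 1) : t = 0 := by
  obtain ⟨n, hn⟩ := Complex.exp_eq_one_iff.1 h
  have hn' : t = n * (2 * Real.pi) := by
    have := congrArg Complex.im hn
    simpa using this
  have hpi := Real.pi_pos
  have h1 : (n:ℝ) < 1 := by
    by_contra hc
    nlinarith [ht.2, not_lt.1 hc]
  have h2 : (-1:ℝ) < n := by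
    by_contra hc
    nlinarith [ht.1, not_lt.1 hc]
  have : n = 0 := by
    have h1' : n < 1 := by exact_mod_cast h1
    have h2' : -1 < n := by exact_mod_cast h2
    omega
  simp [hn', this]

/-- Integrable functions have quasiperiodic primitives, with prescribed mean if `t = 0`. -/
theorem exists_quasiperiodic_primitive {t : ℝ} (ht : t ∈ Set.Ioc (-Real.pi) Real.pi) {f : ℝ → ℂ}
    (hf : IntervalIntegrable f volume 0 1) (h0 : t = 0 → ∫ x in (0:ℝ)..1, f x = 0) (w : ℂ) :
    ∃ G : ℝ → ℂ, ContinuousOn G (Set.Icc 0 1) ∧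
      (∀ x ∈ Set.Icc (0:ℝ) 1, G x = G 0 + ∫ s in (0:ℝ)..x, f s) ∧
      G 1 = Complex.exp (Complex.I * t) * G 0 ∧ (t = 0 → ∫ x in (0:ℝ)..1, G x = w) := by
  have hP : ContinuousOn (fun x => ∫ s in (0:ℝ)..x, f s) (Set.uIcc 0 1) :=
    intervalIntegral.continuousOn_primitive_interval' hf (by simp)
  have hP' := hP
  rw [Set.uIcc_of_le zero_le_one] at hP'
  by_cases h : t = 0
  · refine ⟨fun x => (w - ∫ x in (0:ℝ)..1, ∫ s in (0:ℝ)..x, f s) + ∫ s in (0:ℝ)..x, f s,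
      continuousOn_const.add hP', fun x _ => by simp, by simp [h, h0 h], fun _ => ?_⟩
    rw [intervalIntegral.integral_add (by simp) hP.intervalIntegrable]
    simp
  · have hne : Complex.exp (Complex.I * t) - 1 ≠ 0 := fun hc =>
      h (eq_zero_of_exp_I_mul_eq_one ht (sub_eq_zero.1 hc))
    refine ⟨fun x => (∫ s in (0:ℝ)..1, f s) / (Complex.exp (Complex.I * t) - 1) +
      ∫ s in (0:ℝ)..x, f s, continuousOn_const.add hP', fun x _ => by simp, ?_,
      fun hc => absurd hc h⟩
    simp only [intervalIntegral.integral_same, add_zero]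
    field_simp
    ring

theorem norm_fourierCoeff01_le (q : ℝ → ℂ) (m : ℤ) :
    ‖fourierCoeff01 q m‖ ≤ ∫ x in (0:ℝ)..1, ‖q x‖ := by
  refine (intervalIntegral.norm_integral_le_integral_norm zero_le_one).trans_eq ?_
  congr 1; ext x
  rw [norm_mul, show -(2 * Real.pi * Complex.I * m) * (x : ℂ) =
    -(Complex.I * ((2 * Real.pi * m : ℝ) : ℂ)) * x by push_cast; ring, norm_exp_neg_I_mul, mul_one]

theorem norm_qCoeff_le (t : ℝ) (f : ℝ → ℂ) (n : ℤ) :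
    ‖qCoeff t f n‖ ≤ ∫ x in (0:ℝ)..1, ‖f x‖ := by
  refine (intervalIntegral.norm_integral_le_integral_norm zero_le_one).trans_eq ?_
  congr 1; ext x
  rw [norm_mul, norm_exp_neg_I_mul, mul_one]

theorem qCoeff_sub_const_mul (t : ℝ) {q y : ℝ → ℂ} (hq : IntervalIntegrable q volume 0 1)
    (hy : ContinuousOn y (Set.Icc 0 1)) (lam : ℂ) (n : ℤ) :
    qCoeff t (fun x => (q x - lam) * y x) n =
      qCoeff t (fun x => q x * y x) n - lam * qCoeff t y n := by
  have hy' : ContinuousOn y (Set.uIcc 0 1) := by rwa [Set.uIcc_of_le zero_le_one]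
  have hc := (continuous_exp_neg_qFreq t n).continuousOn (s := Set.uIcc (0:ℝ) 1)
  rw [qCoeff, qCoeff, qCoeff, ← intervalIntegral.integral_const_mul,
    ← intervalIntegral.integral_sub ((hq.mul_continuousOn hy').mul_continuousOn hc)
      ((show ContinuousOn (fun x : ℝ => y x * Complex.exp (-(Complex.I * qFreq t n) * x)) _ from
        hy'.mul hc).intervalIntegrable.const_mul lam)]
  congr 1; ext x; ring

/-- A continuous quasiperiodic function with vanishing coefficients is zero. -/
theorem eq_zero_of_qCoeff_eq_zero {t : ℝ} {y : ℝ → ℂ} (hy : ContinuousOn y (Set.Icc 0 1))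
    (hb : y 1 = Complex.exp (Complex.I * t) * y 0) (h : ∀ n, qCoeff t y n = 0) :
    ∀ x ∈ Set.Icc (0:ℝ) 1, y x = 0 := by
  intro x hx
  have h0 : qCoeff t y = 0 := funext h
  have := hasSum_qCoeff hy hb (by rw [h0]; exact summable_zero) x hx
  simp only [h, zero_mul] at this
  exact this.unique hasSum_zero

/-- The differential equation in terms of coefficients. -/
theorem mul_qCoeff_of_isEigenfunL {q y : ℝ → ℂ} {t : ℝ} {lam : ℂ}
    (hq : IntervalIntegrable q volume 0 1) (h : IsEigenfunL q t lam y) (n : ℤ) :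
    (lam - (qFreq t n : ℂ) ^ 2) * qCoeff t y n = qCoeff t (fun x => q x * y x) n := by
  obtain ⟨g, hyc, hgc, hyg, hg, -, hby, hbg⟩ := h
  have hy' : ContinuousOn y (Set.uIcc 0 1) := by rwa [Set.uIcc_of_le zero_le_one]
  have hg' : ContinuousOn g (Set.uIcc 0 1) := by rwa [Set.uIcc_of_le zero_le_one]
  have hf : IntervalIntegrable (fun x => (q x - lam) * y x) volume 0 1 :=
    (hq.sub intervalIntegrable_const).mul_continuousOn hy'
  have h1 := qCoeff_eq_of_primitive hf hg hbg n
  have h2 := qCoeff_eq_of_primitive hg'.intervalIntegrable hyg hby n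
  rw [qCoeff_sub_const_mul t hq hyc, h2] at h1
  linear_combination -h1 - (qFreq t n : ℂ) ^ 2 * qCoeff t y n * Complex.I_sq

theorem exists_qFreq_sq_of_isEigenfunL {q y : ℝ → ℂ} {t : ℝ} {lam : ℂ}
    (hq : IntervalIntegrable q volume 0 1) (hfour : ∀ m : ℤ, m ≤ 0 → fourierCoeff01 q m = 0)
    (h : IsEigenfunL q t lam y) : ∃ n : ℤ, lam = (qFreq t n : ℂ) ^ 2 := by
  by_contra! hne
  have heq := mul_qCoeff_of_isEigenfunL hq h
  obtain ⟨g, hyc, -, -, -, hnz, hby, -⟩ := h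
  have hpos : ∀ n, 0 < ‖lam - (qFreq t n : ℂ) ^ 2‖ := fun n =>
    norm_pos_iff.2 (sub_ne_zero.2 (hne n))
  have hle : ∀ n, ‖qCoeff t y n‖ = ‖lam - (qFreq t n : ℂ) ^ 2‖⁻¹ *
      ‖qCoeff t (fun x => q x * y x) n‖ := by
    intro n
    rw [← heq n, norm_mul, inv_mul_cancel_left₀ (hpos n).ne']
  have hS := summable_inv_norm_sub_qFreq_sq t lam
  have hsum : Summable (qCoeff t y) := by
    refine Summable.of_norm_bounded (hS.mul_right (∫ x in (0:ℝ)..1, ‖q x * y x‖)) fun n => ?_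
    rw [hle n]
    exact mul_le_mul_of_nonneg_left (norm_qCoeff_le _ _ _) (inv_nonneg.2 (norm_nonneg _))
  have hconv := hasSum_qCoeff_mul hq hsum id (hasSum_qCoeff hyc hby hsum)
  set Q := ∫ x in (0:ℝ)..1, ‖q x‖
  have hQ : 0 ≤ Q := (norm_nonneg _).trans (norm_fourierCoeff01_le q 0)
  have hzero := eq_zero_of_le_mul_tsum_Iio hsum.norm (fun _ => norm_nonneg _) (hS.mul_right Q)
    (fun n => mul_nonneg (inv_nonneg.2 (norm_nonneg _)) hQ) (fun n => by
      rw [hle n, mul_assoc]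
      refine mul_le_mul_of_nonneg_left ?_ (inv_nonneg.2 (norm_nonneg _))
      rw [← (hconv n).tsum_eq, ← tsum_mul_left]
      refine tsum_of_norm_bounded ((hsum.norm.indicator _).mul_left Q).hasSum fun k => ?_
      by_cases hk : k ∈ Set.Iio n
      · rw [Set.indicator_of_mem hk, norm_mul, mul_comm]
        exact mul_le_mul_of_nonneg_right (norm_fourierCoeff01_le _ _) (norm_nonneg _)
      · rw [Set.indicator_of_notMem hk, id, hfour _ (by simp only [Set.mem_Iio] at hk; omega)]
        simp)
  exact hnz (eq_zero_of_qCoeff_eq_zero hyc hby fun n => norm_eq_zero.1 (hzero n))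

/-- A continuous quasiperiodic function whose coefficients solve the differential equation
is an eigenfunction. -/
theorem isEigenfunL_of_mul_qCoeff {q y : ℝ → ℂ} {t : ℝ} {lam : ℂ}
    (ht : t ∈ Set.Ioc (-Real.pi) Real.pi) (hq : IntervalIntegrable q volume 0 1)
    (hyc : ContinuousOn y (Set.Icc 0 1)) (hby : y 1 = Complex.exp (Complex.I * t) * y 0)
    (hnz : ¬ ∀ x ∈ Set.Icc (0:ℝ) 1, y x = 0)
    (h : ∀ n, (lam - (qFreq t n : ℂ) ^ 2) * qCoeff t y n = qCoeff t (fun x => q x * y x) n) :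
    IsEigenfunL q t lam y := by
  have hy' : ContinuousOn y (Set.uIcc 0 1) := by rwa [Set.uIcc_of_le zero_le_one]
  have hf : IntervalIntegrable (fun x => (q x - lam) * y x) volume 0 1 :=
    (hq.sub intervalIntegrable_const).mul_continuousOn hy'
  have hfc : ∀ n, qCoeff t (fun x => (q x - lam) * y x) n =
      -(qFreq t n : ℂ) ^ 2 * qCoeff t y n := by
    intro n
    rw [qCoeff_sub_const_mul t hq hyc, ← h n]; ring
  have hzero : ∀ {F : ℝ → ℂ}, t = 0 → qCoeff t F 0 = ∫ x in (0:ℝ)..1, F x := by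
    rintro F rfl
    simp [qCoeff, qFreq]
  have hf0 : t = 0 → ∫ x in (0:ℝ)..1, (q x - lam) * y x = 0 := by
    intro h0
    rw [← hzero h0, hfc 0, h0]
    simp [qFreq]
  obtain ⟨g, hgc, hg, hbg, hg0⟩ := exists_quasiperiodic_primitive ht hf hf0 0
  have hg' : ContinuousOn g (Set.uIcc 0 1) := by rwa [Set.uIcc_of_le zero_le_one]
  obtain ⟨Y, hYc, hY, hbY, hY0⟩ := exists_quasiperiodic_primitive ht hg'.intervalIntegrable hg0
    (∫ x in (0:ℝ)..1, y x)
  have hY' : ContinuousOn Y (Set.uIcc 0 1) := by rwa [Set.uIcc_of_le zero_le_one]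
  have hcoef : ∀ n, qCoeff t Y n = qCoeff t y n := by
    intro n
    have h1 := qCoeff_eq_of_primitive hf hg hbg n
    have h2 := qCoeff_eq_of_primitive hg'.intervalIntegrable hY hbY n
    by_cases hw : qFreq t n = 0
    · have hexp : Complex.exp (Complex.I * t) = 1 := by
        rw [← qExp_one t n, qExp, hw]; simp
      have ht0 := eq_zero_of_exp_I_mul_eq_one ht hexp
      have hn0 : n = 0 := by
        rw [qFreq, ht0] at hw
        simpa [Real.pi_ne_zero] using hw
      rw [hn0, hzero ht0, hzero ht0, hY0 ht0]
    · have hw' : (qFreq t n : ℂ) ^ 2 ≠ 0 := pow_ne_zero 2 (by exact_mod_cast hw)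
      refine mul_left_cancel₀ hw' ?_
      rw [h2, hfc] at h1
      linear_combination h1 + (qFreq t n : ℂ) ^ 2 * qCoeff t Y n * Complex.I_sq
  have hYy : ∀ x ∈ Set.Icc (0:ℝ) 1, Y x - y x = 0 := by
    refine eq_zero_of_qCoeff_eq_zero (t := t) (hYc.sub hyc) (by rw [hbY, hby]; ring) fun n => ?_
    have hc := (continuous_exp_neg_qFreq t n).continuousOn (s := Set.uIcc (0:ℝ) 1)
    have hn := hcoef n
    rw [← sub_eq_zero, qCoeff, qCoeff, ← intervalIntegral.integral_sub
      (hY'.intervalIntegrable.mul_continuousOn hc)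
      (hy'.intervalIntegrable.mul_continuousOn hc)] at hn
    rw [qCoeff, ← hn]
    congr 1; ext x; ring
  refine ⟨g, hyc, hgc, fun x hx => ?_, hg, hnz, hby, hbg⟩
  rw [← sub_eq_zero.1 (hYy x hx), ← sub_eq_zero.1 (hYy 0 (by simp)), hY x hx]

theorem fourierCoeff01_one (m : ℤ) : fourierCoeff01 (fun _ => 1) m = if m = 0 then 1 else 0 := by
  split_ifs with hm
  · simp [fourierCoeff01, hm]
  · have hne : -(2 * Real.pi * Complex.I * m) ≠ (0:ℂ) := by
      simp [Real.pi_ne_zero, hm]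
    simp only [fourierCoeff01, one_mul]
    rw [integral_exp_mul_complex hne]
    have : Complex.exp (-(2 * Real.pi * Complex.I * m) * (1:ℝ)) = 1 :=
      Complex.exp_eq_one_iff.2 ⟨-m, by push_cast; ring⟩
    rw [this]; simp

theorem exists_max_qFreq_sq_eq (t : ℝ) (n₀ : ℤ) :
    ∃ n : ℤ, (qFreq t n) ^ 2 = (qFreq t n₀) ^ 2 ∧
      ∀ k, n < k → (qFreq t k) ^ 2 ≠ (qFreq t n₀) ^ 2 := by
  have hinj : ∀ {a b : ℤ}, qFreq t a = qFreq t b → a = b := by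
    intro a b h
    simpa [qFreq, Real.pi_ne_zero] using h
  by_cases hex : ∃ k, n₀ < k ∧ (qFreq t k) ^ 2 = (qFreq t n₀) ^ 2
  · obtain ⟨n, hn, hsq⟩ := hex
    refine ⟨n, hsq, fun k hk hk' => ?_⟩
    rcases sq_eq_sq_iff_eq_or_eq_neg.1 hk' with h | h
    · exact absurd (hinj h) (by omega)
    rcases sq_eq_sq_iff_eq_or_eq_neg.1 hsq with h' | h'
    · exact absurd (hinj h') (by omega)
    exact absurd (hinj (h.trans h'.symm)) (by omega)
  · push Not at hex
    exact ⟨n₀, rfl, hex⟩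

/-- An absolutely convergent one-sided quasiperiodic series and its coefficients. -/
theorem exists_hasSum_qExp_add {d : ℕ → ℂ} (hds : Summable d) (t : ℝ) (n : ℤ) :
    ∃ y : ℝ → ℂ, Continuous y ∧ y 1 = Complex.exp (Complex.I * t) * y 0 ∧
      (∀ x, HasSum (fun j : ℕ => d j * qExp t (n + j) x) (y x)) ∧
      (∀ k, k < n → qCoeff t y k = 0) ∧ ∀ j : ℕ, qCoeff t y (n + j) = d j := by
  let y : ℝ → ℂ := fun x => ∑' j : ℕ, d j * qExp t (n + j) x
  have hterm : ∀ (j : ℕ) (x : ℝ), ‖d j * qExp t (n + j) x‖ ≤ ‖d j‖ := fun j x => by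
    rw [norm_mul, norm_qExp, mul_one]
  have hy : ∀ x, HasSum (fun j : ℕ => d j * qExp t (n + j) x) (y x) := fun x =>
    (Summable.of_norm_bounded hds.norm fun j => hterm j x).hasSum
  have hyc : Continuous y :=
    continuous_tsum (fun j => continuous_const.mul (continuous_qExp t _)) hds.norm hterm
  have hby : y 1 = Complex.exp (Complex.I * t) * y 0 := by
    simp only [y, qExp_one, qExp_zero, mul_one, tsum_mul_right]
    ring
  have hcoef : ∀ k, HasSum (fun j : ℕ => if k = n + j then d j else 0) (qCoeff t y k) := by
    intro k
    have := hasSum_qCoeff_mul (q := fun _ => 1) intervalIntegrable_const hds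
      (fun j : ℕ => n + (j : ℤ)) (t := t) (fun x _ => hy x) k
    simpa [fourierCoeff01_one, sub_eq_zero] using this
  have hcoef_lt : ∀ k, k < n → qCoeff t y k = 0 := by
    intro k hk
    refine (hcoef k).unique ?_
    convert hasSum_zero using 2 with j
    exact if_neg (by omega)
  have hcoef_add : ∀ j : ℕ, qCoeff t y (n + j) = d j := by
    intro j
    refine (hcoef _).unique ?_
    have he : (fun i : ℕ => if n + (j : ℤ) = n + i then d i else 0) =
        fun i => if i = j then d j else 0 := by
      ext i
      by_cases hij : i = j
      · simp [hij]
      · rw [if_neg (by omega), if_neg hij]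
    rw [he]
    exact hasSum_ite_eq j (d j)
  exact ⟨y, hyc, hby, hy, hcoef_lt, hcoef_add⟩

theorem exists_isEigenfunL_of_qFreq_sq {q : ℝ → ℂ} {t : ℝ}
    (ht : t ∈ Set.Ioc (-Real.pi) Real.pi) (hq : IntervalIntegrable q volume 0 1)
    (hfour : ∀ m : ℤ, m ≤ 0 → fourierCoeff01 q m = 0) (n₀ : ℤ) :
    ∃ y, IsEigenfunL q t ((qFreq t n₀ : ℂ) ^ 2) y := by
  obtain ⟨n, hn, hmax⟩ := exists_max_qFreq_sq_eq t n₀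
  set lam : ℂ := (qFreq t n₀ : ℂ) ^ 2 with hlam
  have hlamn : lam - (qFreq t n : ℂ) ^ 2 = 0 := by
    rw [hlam, sub_eq_zero]; exact_mod_cast hn.symm
  have hne : ∀ k, n < k → lam - (qFreq t k : ℂ) ^ 2 ≠ 0 := by
    intro k hk h
    refine hmax k hk ?_
    rw [hlam, sub_eq_zero] at h
    exact_mod_cast h.symm
  let a : ℕ → ℂ := fun j => (lam - (qFreq t (n + j) : ℂ) ^ 2)⁻¹
  let p : ℕ → ℂ := fun m => fourierCoeff01 q m
  set d : ℕ → ℂ := convRec a p with hd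
  have ha : Summable fun j => ‖a j‖ := by
    have := (summable_inv_norm_sub_qFreq_sq t lam).comp_injective
      (i := fun j : ℕ => n + (j : ℤ)) (fun i j h => by simpa using h)
    refine this.congr fun j => ?_
    simp [a]
  have hds : Summable d := summable_convRec (fun m => norm_fourierCoeff01_le q m) ha
  obtain ⟨y, hyc, hby, hy, hcoef_lt, hcoef_add⟩ := exists_hasSum_qExp_add hds t n
  have hconv := fun k => hasSum_qCoeff_mul hq hds (fun j : ℕ => n + (j : ℤ)) (fun x _ => hy x) k
  refine ⟨y, isEigenfunL_of_mul_qCoeff ht hq hyc.continuousOn hby (fun h => ?_) fun k => ?_⟩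
  · have h1 : qCoeff t y n = 1 := by
      have := hcoef_add 0
      simpa [hd, convRec] using this
    have h2 : qCoeff t y n = 0 := by
      refine (intervalIntegral.integral_congr (g := fun _ => (0:ℂ)) fun x hx => ?_).trans
        intervalIntegral.integral_zero
      rw [Set.uIcc_of_le zero_le_one] at hx
      simp [h x hx]
    exact one_ne_zero (h1.symm.trans h2)
  · rcases lt_or_ge n k with hk | hk
    · obtain ⟨j, rfl⟩ : ∃ j : ℕ, k = n + (j + 1 : ℕ) := ⟨(k - n - 1).toNat, by omega⟩
      rw [hcoef_add, hd, convRec_succ, mul_inv_cancel_left₀ (hne _ hk)]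
      refine HasSum.unique (f := fun i : ℕ =>
        d i * fourierCoeff01 q (n + (j + 1 : ℕ) - (n + (i : ℤ)))) ?_ (hconv _)
      have hsum : ∑ i ∈ Finset.range (j + 1), p (j + 1 - i) * convRec a p i =
          ∑ i ∈ Finset.range (j + 1),
            d i * fourierCoeff01 q (n + (j + 1 : ℕ) - (n + (i : ℤ))) := by
        refine Finset.sum_congr rfl fun i hi => ?_
        rw [Finset.mem_range] at hi
        rw [mul_comm, show n + ((j + 1 : ℕ) : ℤ) - (n + (i : ℤ)) = ((j + 1 - i : ℕ) : ℤ) by omega]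
      rw [hsum]
      refine hasSum_sum_of_ne_finset_zero fun i hi => ?_
      rw [Finset.mem_range] at hi
      rw [hfour _ (by omega), mul_zero]
    · have hl : (lam - (qFreq t k : ℂ) ^ 2) * qCoeff t y k = 0 := by
        rcases hk.lt_or_eq with hk' | rfl
        · rw [hcoef_lt k hk', mul_zero]
        · rw [hlamn, zero_mul]
      rw [hl]
      refine HasSum.unique ?_ (hconv k)
      convert hasSum_zero using 2 with j
      rw [hfour _ (by omega), mul_zero]

theorem spectrum_L_gasymov (q : ℝ → ℂ) (hper : ∀ x : ℝ, q (x + 1) = q x)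
    (hint : IntegrableOn q (Set.Icc (0:ℝ) 1))
    (hfour : ∀ m : ℤ, m ≤ 0 → fourierCoeff01 q m = 0)
    (t : ℝ) (ht : t ∈ Set.Ioc (-Real.pi) Real.pi) :
    ∀ lam : ℂ, IsEigenvalueL q t lam ↔
      ∃ n : ℤ, lam = (((2 * Real.pi * n + t : ℝ) : ℂ))^2 := by
  have hq : IntervalIntegrable q volume 0 1 :=
    (intervalIntegrable_iff_integrableOn_Icc_of_le zero_le_one).2 hint
  intro lam
  constructor
  · rintro ⟨y, hy⟩
    exact exists_qFreq_sq_of_isEigenfunL hq hfour hy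
  · rintro ⟨n, rfl⟩
    exact exists_isEigenfunL_of_qFreq_sq ht hq hfour n
end
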